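/- Let A ∈ ℝ^{n×N}, τ, λ > 0 with τ‖A‖²_{2→2} ≤ 1, L ≥ 2, B_in, B_out > 0, and suppose the samples x_1, …, x_m ∈ ℝ^N are drawn i.i.d. according to a probability distribution D with ‖x_i‖₂ ≤ B_in almost surely; set y_i = A x_i and Y = (y_1|…|y_m). Then for every δ ∈ (0,1), with probability at least 1 − δ over the draw of the samples, for all h in the hypothesis class H_2^L, the true risk L(h) = E_{x∼D} ‖h(Ax) − x‖₂ satisfies L(h) ≤ L̂(h) + 8B_out·√(Nn/m)·√(1 + log(2 + 8L(L+3)·τ‖Y‖_F‖A‖_{2→2}/(√m·B_out))) + 8B_out·(N/√m)·√(log(e(1 + 8τL‖A‖_{2→2}‖Y‖_F/(√m·B_out)))) + 4(B_in + B_out)·√(2log(4/δ)/m), where L̂(h) = (1/m) Σ_{i=1}^m ‖h(y_i) − x_i‖₂. -/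

import Mathlib

open MeasureTheory Matrix
open scoped ENNReal

noncomputable def soft (mu x : ℝ) : ℝ := Real.sign x * max 0 (|x| - mu)

noncomputable def softMat {a b : ℕ} (mu : ℝ) (M : Matrix (Fin a) (Fin b) ℝ) :
    Matrix (Fin a) (Fin b) ℝ := Matrix.of fun i j => soft mu (M i j)

noncomputable def specNorm {a b : ℕ} (A : Matrix (Fin a) (Fin b) ℝ) : ℝ :=
  ‖LinearMap.toContinuousLinearMap (Matrix.toEuclideanLin A)‖

noncomputable def frobNorm {a b : ℕ} (A : Matrix (Fin a) (Fin b) ℝ) : ℝ :=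
  Real.sqrt (∑ i, ∑ j, (A i j) ^ 2)

noncomputable def l2 {N : ℕ} (x : Fin N → ℝ) : ℝ := Real.sqrt (∑ i, x i ^ 2)

noncomputable def sigma {N : ℕ} (B : ℝ) (x : Fin N → ℝ) : Fin N → ℝ :=
  if l2 x ≤ B then x else (B / l2 x) • x

noncomputable def sigmaMat {N m : ℕ} (B : ℝ) (M : Matrix (Fin N) (Fin m) ℝ) :
    Matrix (Fin N) (Fin m) ℝ := Matrix.of fun i j => sigma B (fun k => M k j) i

def IsOrthogonal {N : ℕ} (Φ : Matrix (Fin N) (Fin N) ℝ) : Prop := Φᵀ * Φ = 1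

noncomputable def ista {n N m : ℕ} (A : Matrix (Fin n) (Fin N) ℝ) (τ lam : ℝ)
    (Φ : Matrix (Fin N) (Fin N) ℝ) (Y : Matrix (Fin n) (Fin m) ℝ) :
    ℕ → Matrix (Fin N) (Fin m) ℝ
  | 0 => 0
  | l + 1 => softMat (τ * lam)
      ((1 - τ • (Φᵀ * Aᵀ * A * Φ)) * ista A τ lam Φ Y l + τ • ((A * Φ)ᵀ * Y))

noncomputable def istaVec {n N : ℕ} (A : Matrix (Fin n) (Fin N) ℝ) (τ lam : ℝ)
    (Φ : Matrix (Fin N) (Fin N) ℝ) (y : Fin n → ℝ) : ℕ → Fin N → ℝ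
  | 0 => 0
  | l + 1 => soft (τ * lam) ∘
      ((1 - τ • (Φᵀ * Aᵀ * A * Φ)) *ᵥ istaVec A τ lam Φ y l + τ • ((A * Φ)ᵀ *ᵥ y))

noncomputable def KL {n N m : ℕ} (A : Matrix (Fin n) (Fin N) ℝ) (τ : ℝ)
    (Y : Matrix (Fin n) (Fin m) ℝ) (L : ℕ) : ℝ :=
  τ * frobNorm Y * specNorm (1 - τ • (Aᵀ * A)) ^ (L - 1)
    + τ * frobNorm Y * ∑ l ∈ Finset.Icc 2 L,
        specNorm (1 - τ • (Aᵀ * A)) ^ (L - l) *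
          (1 + 2 * τ * specNorm A ^ 2 *
            ∑ k ∈ Finset.range (l - 1), specNorm (1 - τ • (Aᵀ * A)) ^ k)

noncomputable def ML {n N m : ℕ} (A : Matrix (Fin n) (Fin N) ℝ) (τ : ℝ)
    (Y : Matrix (Fin n) (Fin m) ℝ) (L : ℕ) : ℝ :=
  τ * specNorm A * frobNorm Y * ∑ k ∈ Finset.range L, specNorm (1 - τ • (Aᵀ * A)) ^ k

noncomputable def coveringNumber {α : Type*} (d : α → α → ℝ) (s : Set α) (ε : ℝ) : ℝ≥0∞ :=
  ⨅ (t : Finset α) (_ : ∀ x ∈ s, ∃ y ∈ t, d x y ≤ ε), (t.card : ℝ≥0∞)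

theorem net_card {E : Type*} [NormedAddCommGroup E] [NormedSpace ℝ E] [FiniteDimensional ℝ E]
    (r : ℝ) (hr : 0 < r) (s : Finset E) (hs : ∀ c ∈ s, ‖c‖ ≤ 1)
    (h : ∀ c ∈ s, ∀ d ∈ s, c ≠ d → r ≤ ‖c - d‖) :
    (s.card : ℝ) ≤ (1 + 2 / r) ^ Module.finrank ℝ E := by
  borelize E
  let μ : Measure E := Measure.addHaar
  let δ : ℝ := r / 2
  let ρ : ℝ := 1 + r / 2
  have δpos : 0 < δ := by positivity
  have ρpos : 0 < ρ := by positivity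
  set A := ⋃ c ∈ s, Metric.ball (c : E) δ with hA
  have D : Set.Pairwise (s : Set E) (Function.onFun Disjoint fun c => Metric.ball (c : E) δ) := by
    rintro c hc d hd hcd
    apply Metric.ball_disjoint_ball
    rw [dist_eq_norm]
    have := h c hc d hd hcd
    simp only [δ]; linarith
  have A_subset : A ⊆ Metric.ball (0 : E) ρ := by
    refine Set.iUnion₂_subset fun x hx => ?_
    apply Metric.ball_subset_ball'
    have := hs x hx
    rw [dist_zero_right]; simp only [δ, ρ]; linarith
  have I :
    (s.card : ℝ≥0∞) * ENNReal.ofReal (δ ^ Module.finrank ℝ E) * μ (Metric.ball 0 1) ≤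
      ENNReal.ofReal (ρ ^ Module.finrank ℝ E) * μ (Metric.ball 0 1) :=
    calc
      (s.card : ℝ≥0∞) * ENNReal.ofReal (δ ^ Module.finrank ℝ E) * μ (Metric.ball 0 1) = μ A := by
        rw [hA, measure_biUnion_finset D fun c _ => measurableSet_ball]
        simp only [μ.addHaar_ball_of_pos _ δpos]
        simp only [Finset.sum_const, nsmul_eq_mul, mul_assoc]
      _ ≤ μ (Metric.ball (0 : E) ρ) := measure_mono A_subset
      _ = ENNReal.ofReal (ρ ^ Module.finrank ℝ E) * μ (Metric.ball 0 1) := by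
        simp only [μ.addHaar_ball_of_pos _ ρpos]
  have J : (s.card : ℝ≥0∞) * ENNReal.ofReal (δ ^ Module.finrank ℝ E) ≤
      ENNReal.ofReal (ρ ^ Module.finrank ℝ E) :=
    (ENNReal.mul_le_mul_iff_left (Metric.measure_ball_pos _ _ zero_lt_one).ne'
      measure_ball_lt_top.ne).1 I
  have K := ENNReal.toReal_le_of_le_ofReal (pow_nonneg ρpos.le _) J
  rw [ENNReal.toReal_mul, ENNReal.toReal_ofReal (by positivity), ENNReal.toReal_natCast] at K
  have e : (1 + 2 / r) = ρ / δ := by simp only [ρ, δ]; field_simp; ring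
  rw [e, div_pow, le_div_iff₀ (by positivity)]
  exact K

theorem exists_net {E : Type*} [NormedAddCommGroup E] [NormedSpace ℝ E] [FiniteDimensional ℝ E]
    (r : ℝ) (hr : 0 < r) : ∃ s : Finset E, s.Nonempty ∧ (∀ c ∈ s, ‖c‖ ≤ 1) ∧
      (∀ x : E, ‖x‖ ≤ 1 → ∃ c ∈ s, ‖x - c‖ ≤ r) ∧
      (s.card : ℝ) ≤ (1 + 2 / r) ^ Module.finrank ℝ E := by
  classical
  let Q : Set ℕ := {k | ∃ s : Finset E, s.card = k ∧ (∀ c ∈ s, ‖c‖ ≤ 1) ∧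
    ∀ c ∈ s, ∀ d ∈ s, c ≠ d → r ≤ ‖c - d‖}
  have hne : Q.Nonempty := ⟨0, ∅, by simp⟩
  have hb : BddAbove Q := by
    refine ⟨⌊(1 + 2 / r) ^ Module.finrank ℝ E⌋₊, ?_⟩
    rintro k ⟨s, rfl, h1, h2⟩
    exact Nat.le_floor (net_card r hr s h1 h2)
  obtain ⟨s, hs, h1, h2⟩ := Nat.sSup_mem hne hb
  have cov : ∀ x : E, ‖x‖ ≤ 1 → ∃ c ∈ s, ‖x - c‖ ≤ r := by
    intro x hx
    by_contra! hcon
    have hxs : x ∉ s := fun hxs => by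
      have := hcon x hxs
      simp at this; linarith
    have : (insert x s).card ∈ Q := by
      refine ⟨insert x s, rfl, ?_, ?_⟩
      · intro c hc
        rcases Finset.mem_insert.1 hc with rfl | hc
        · exact hx
        · exact h1 c hc
      · intro c hc d hd hcd
        rcases Finset.mem_insert.1 hc with rfl | hc' <;> rcases Finset.mem_insert.1 hd with rfl | hd'
        · exact absurd rfl hcd
        · exact (hcon d hd').le
        · rw [norm_sub_rev]; exact (hcon c hc').le
        · exact h2 c hc' d hd' hcd
    have h3 := le_csSup hb this
    rw [Finset.card_insert_of_notMem hxs] at h3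
    omega
  refine ⟨s, ?_, h1, cov, net_card r hr s h1 h2⟩
  obtain ⟨c, hc, _⟩ := cov 0 (by simp)
  exact ⟨c, hc⟩

noncomputable def sg (b : Bool) : ℝ := if b then 1 else -1

theorem sg_not (b : Bool) : sg (!b) = - sg b := by cases b <;> simp [sg]
theorem sg_sq (b : Bool) : sg b ^ 2 = 1 := by cases b <;> simp [sg]
theorem abs_sg (b : Bool) : |sg b| = 1 := by cases b <;> simp [sg]

noncomputable def radW {m : ℕ} {ι : Type*} (T : Finset ι) (hT : T.Nonempty)
    (w : ι → Fin m → ℝ) : ℝ :=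
  (1 / 2 ^ m) * ∑ e : Fin m → Bool, T.sup' hT (fun p => ∑ i, sg (e i) * w p i)

theorem avg_le {m : ℕ} {f g : (Fin m → Bool) → ℝ} (h : ∀ e, f e ≤ g e) :
    (1 / 2 ^ m : ℝ) * ∑ e, f e ≤ (1 / 2 ^ m) * ∑ e, g e :=
  mul_le_mul_of_nonneg_left (Finset.sum_le_sum fun e _ => h e) (by positivity)

theorem avg_const {m : ℕ} (c : ℝ) : (1 / 2 ^ m : ℝ) * ∑ _e : Fin m → Bool, c = c := by
  simp

theorem avg_linear {m : ℕ} (u : Fin m → ℝ) :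
    (1 / 2 ^ m : ℝ) * ∑ e : Fin m → Bool, ∑ i, sg (e i) * u i = 0 := by
  have h : ∑ e : Fin m → Bool, ∑ i, sg (e i) * u i
      = ∑ e : Fin m → Bool, ∑ i, sg (!(e i)) * u i := by
    let σ : (Fin m → Bool) ≃ (Fin m → Bool) :=
      { toFun := fun e i => !(e i), invFun := fun e i => !(e i)
        left_inv := fun e => by ext; simp
        right_inv := fun e => by ext; simp }
    exact (Equiv.sum_comp σ (fun e : Fin m → Bool => ∑ i, sg (e i) * u i)).symm
  simp only [sg_not, neg_mul, Finset.sum_neg_distrib] at h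
  have : ∑ e : Fin m → Bool, ∑ i, sg (e i) * u i = 0 := by linarith
  rw [this, mul_zero]

theorem avg_exp {m : ℕ} (u : Fin m → ℝ) :
    (1 / 2 ^ m : ℝ) * ∑ e : Fin m → Bool, Real.exp (∑ i, sg (e i) * u i)
      ≤ Real.exp ((∑ i, u i ^ 2) / 2) := by
  have h1 : ∑ e : Fin m → Bool, Real.exp (∑ i, sg (e i) * u i)
      = ∏ i, ∑ b : Bool, Real.exp (sg b * u i) := by
    rw [Finset.prod_univ_sum]
    rw [Fintype.piFinset_univ]
    simp only [Real.exp_sum]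
  have h2 : ∀ i, ∑ b : Bool, Real.exp (sg b * u i) = 2 * Real.cosh (u i) := by
    intro i; simp [sg, Real.cosh_eq]; ring
  rw [h1]
  simp only [h2]
  rw [Finset.prod_mul_distrib, Finset.prod_const, Finset.card_univ, Fintype.card_fin, ← mul_assoc,
    one_div_mul_cancel (by positivity), one_mul, Finset.sum_div, Real.exp_sum]
  exact Finset.prod_le_prod (fun i _ => (Real.cosh_pos _).le) (fun i _ => Real.cosh_le_exp_half_sq _)

theorem radW_massart_aux {m : ℕ} {ι : Type*} (T : Finset ι) (hT : T.Nonempty)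
    (w : ι → Fin m → ℝ) (s B l : ℝ) (hl : 0 < l)
    (hw : ∀ p ∈ T, ∑ i, w p i ^ 2 ≤ s ^ 2) (hB : Real.log T.card ≤ B) :
    radW T hT w ≤ B / l + l * s ^ 2 / 2 := by
  have hc : (0:ℝ) < T.card := by exact_mod_cast hT.card_pos
  have key : Real.exp (l * radW T hT w) ≤ T.card * Real.exp (l ^ 2 * s ^ 2 / 2) := by
    have hJ : Real.exp (l * radW T hT w) ≤ (1 / 2 ^ m : ℝ) * ∑ e : Fin m → Bool,
        Real.exp (l * T.sup' hT (fun p => ∑ i, sg (e i) * w p i)) := by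
      have := convexOn_exp.map_sum_le (t := (Finset.univ : Finset (Fin m → Bool)))
        (w := fun _ => (1 / 2 ^ m : ℝ))
        (p := fun e => l * T.sup' hT (fun p => ∑ i, sg (e i) * w p i))
        (fun _ _ => by positivity) (by simp) (fun _ _ => Set.mem_univ _)
      simp only [smul_eq_mul, ← Finset.mul_sum] at this
      have e1 : l * radW T hT w = (1 / 2 ^ m) * (l * ∑ e : Fin m → Bool,
          T.sup' hT (fun p => ∑ i, sg (e i) * w p i)) := by
        unfold radW
        ring
      rw [e1]
      exact this
    refine hJ.trans ?_
    have h2 : ∀ e : Fin m → Bool, Real.exp (l * T.sup' hT (fun p => ∑ i, sg (e i) * w p i))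
        ≤ ∑ p ∈ T, Real.exp (∑ i, sg (e i) * (l * w p i)) := by
      intro e
      obtain ⟨p, hp, hpe⟩ := Finset.exists_mem_eq_sup' hT (fun p => ∑ i, sg (e i) * w p i)
      rw [hpe]
      have : l * ∑ i, sg (e i) * w p i = ∑ i, sg (e i) * (l * w p i) := by
        rw [Finset.mul_sum]; exact Finset.sum_congr rfl fun i _ => by ring
      rw [this]
      exact Finset.single_le_sum (f := fun p => Real.exp (∑ i, sg (e i) * (l * w p i)))
        (fun p _ => (Real.exp_pos _).le) hp
    refine (avg_le h2).trans ?_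
    rw [Finset.sum_comm, Finset.mul_sum]
    calc _ ≤ ∑ p ∈ T, Real.exp (l ^ 2 * s ^ 2 / 2) := by
          refine Finset.sum_le_sum fun p hp => (avg_exp _).trans (Real.exp_le_exp.2 ?_)
          have := hw p hp
          simp only [mul_pow, ← Finset.mul_sum]
          have := mul_le_mul_of_nonneg_left this (sq_nonneg l)
          linarith
      _ = _ := by simp
  have h3 : l * radW T hT w ≤ B + l ^ 2 * s ^ 2 / 2 := by
    have := Real.log_le_log (Real.exp_pos _) key
    rw [Real.log_exp, Real.log_mul hc.ne' (Real.exp_pos _).ne', Real.log_exp] at this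
    linarith
  have : B / l + l * s ^ 2 / 2 = (B + l ^ 2 * s ^ 2 / 2) / l := by field_simp
  rw [this, le_div_iff₀ hl]; linarith

theorem radW_massart {m : ℕ} {ι : Type*} (T : Finset ι) (hT : T.Nonempty)
    (w : ι → Fin m → ℝ) (s B : ℝ) (hs : 0 < s) (hB0 : 0 ≤ B)
    (hw : ∀ p ∈ T, ∑ i, w p i ^ 2 ≤ s ^ 2) (hB : Real.log T.card ≤ B) :
    radW T hT w ≤ s * Real.sqrt (2 * B) := by
  have h := fun l hl => radW_massart_aux T hT w s B l hl hw hB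
  rcases hB0.eq_or_lt with rfl | hB0
  · simp only [mul_zero, Real.sqrt_zero]
    by_contra! hcon
    have := h (radW T hT w / s ^ 2) (by positivity)
    have e : radW T hT w / s ^ 2 * s ^ 2 = radW T hT w := by field_simp
    rw [e] at this
    simp at this; linarith
  · set q := Real.sqrt (2 * B) with hq
    have hq0 : 0 < q := Real.sqrt_pos.2 (by positivity)
    have hqq : q ^ 2 = 2 * B := Real.sq_sqrt (by positivity)
    have := h (q / s) (by positivity)
    have e : B / (q / s) + q / s * s ^ 2 / 2 = s * q := by
      have : B = q ^ 2 / 2 := by linarith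
      rw [this]; field_simp; ring
    linarith

theorem radW_step {m : ℕ} {ι : Type*} (T T' : Finset ι) (hT : T.Nonempty) (hT' : T'.Nonempty)
    (w : ι → Fin m → ℝ) (π : ι → ι) (hπ : ∀ p ∈ T, π p ∈ T') :
    radW T hT w ≤ radW T' hT' w + radW T hT (fun p i => w p i - w (π p) i) := by
  unfold radW
  rw [← mul_add, ← Finset.sum_add_distrib]
  refine avg_le fun e => ?_
  refine Finset.sup'_le _ _ fun p hp => ?_
  have h1 := Finset.le_sup' (fun p => ∑ i, sg (e i) * w p i) (hπ p hp)
  have h2 := Finset.le_sup' (fun p => ∑ i, sg (e i) * (w p i - w (π p) i)) hp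
  simp only [mul_sub, Finset.sum_sub_distrib] at h1 h2 ⊢
  linarith

theorem radW_crude {m : ℕ} {ι : Type*} (T : Finset ι) (hT : T.Nonempty)
    (w : ι → Fin m → ℝ) (s : ℝ) (hs : 0 ≤ s)
    (hw : ∀ p ∈ T, ∑ i, w p i ^ 2 ≤ s ^ 2) :
    radW T hT w ≤ Real.sqrt m * s := by
  unfold radW
  refine (avg_le (g := fun _ => Real.sqrt m * s) fun e => ?_).trans (avg_const _).le
  refine Finset.sup'_le _ _ fun p hp => ?_
  have := Finset.sum_mul_sq_le_sq_mul_sq Finset.univ (fun i => sg (e i)) (w p)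
  simp only [sg_sq] at this
  apply le_of_sq_le_sq _ (by positivity)
  rw [mul_pow, Real.sq_sqrt (by positivity)]
  refine this.trans ?_
  simp only [Finset.sum_const, Finset.card_univ, Fintype.card_fin, nsmul_eq_mul, mul_one]
  exact mul_le_mul_of_nonneg_left (hw p hp) (by positivity)

theorem radW_shift {m : ℕ} {ι : Type*} (T : Finset ι) (hT : T.Nonempty)
    (w : ι → Fin m → ℝ) (u : Fin m → ℝ) :
    radW T hT w ≤ radW T hT (fun p i => w p i - u i) := by
  unfold radW
  have h : ∀ e : Fin m → Bool, T.sup' hT (fun p => ∑ i, sg (e i) * w p i) ≤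
      T.sup' hT (fun p => ∑ i, sg (e i) * (w p i - u i)) + ∑ i, sg (e i) * u i := by
    intro e
    refine Finset.sup'_le _ _ fun p hp => ?_
    have h2 := Finset.le_sup' (fun p => ∑ i, sg (e i) * (w p i - u i)) hp
    simp only [mul_sub, Finset.sum_sub_distrib] at h2 ⊢
    linarith
  refine (avg_le h).trans ?_
  rw [Finset.sum_add_distrib, mul_add, avg_linear, add_zero]

theorem sqrt_add_le' (x y : ℝ) (hx : 0 ≤ x) (hy : 0 ≤ y) :
    Real.sqrt (x + y) ≤ Real.sqrt x + Real.sqrt y := by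
  rw [Real.sqrt_le_iff]
  refine ⟨by positivity, ?_⟩
  have h1 := Real.sq_sqrt hx
  have h2 := Real.sq_sqrt hy
  have := mul_nonneg (Real.sqrt_nonneg x) (Real.sqrt_nonneg y)
  nlinarith

theorem geo_sum (n : ℕ) (c : ℝ) :
    ∑ i ∈ Finset.range n, (1 / 2 : ℝ) ^ i * (i + c) = 2 + 2 * c - 2 * (1 / 2) ^ n * (n + 1 + c) := by
  induction n with
  | zero => simp; ring
  | succ n ih => rw [Finset.sum_range_succ, ih, pow_succ]; push_cast; ring

theorem sqrt_sum (n : ℕ) (a : ℝ) (ha : 0 ≤ a) :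
    ∑ i ∈ Finset.range n, (1 / 2 : ℝ) ^ i * Real.sqrt (i + 1 + a) ≤ 2 * Real.sqrt (2 + a) := by
  set s := Real.sqrt (2 + a) with hs
  have hs0 : 0 < s := Real.sqrt_pos.2 (by positivity)
  have hss : s ^ 2 = 2 + a := Real.sq_sqrt (by positivity)
  have h1 : ∀ i : ℕ, Real.sqrt (i + 1 + a) ≤ (i + (3 + 2 * a)) / (2 * s) := by
    intro i
    rw [le_div_iff₀ (by positivity)]
    have h2 : Real.sqrt (i + 1 + a) ^ 2 = i + 1 + a := Real.sq_sqrt (by positivity)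
    nlinarith [sq_nonneg (Real.sqrt (i + 1 + a) - s)]
  calc _ ≤ ∑ i ∈ Finset.range n, (1 / 2 : ℝ) ^ i * ((i + (3 + 2 * a)) / (2 * s)) :=
        Finset.sum_le_sum fun i _ => mul_le_mul_of_nonneg_left (h1 i) (by positivity)
    _ = (∑ i ∈ Finset.range n, (1 / 2 : ℝ) ^ i * (i + (3 + 2 * a))) / (2 * s) := by
        rw [Finset.sum_div]; exact Finset.sum_congr rfl fun i _ => by ring
    _ ≤ (2 + 2 * (3 + 2 * a)) / (2 * s) := by
        rw [geo_sum]
        have : 0 ≤ 2 * (1 / 2 : ℝ) ^ n * (n + 1 + (3 + 2 * a)) := by positivity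
        gcongr; linarith
    _ = 2 * s := by
        rw [div_eq_iff (by positivity)]; nlinarith

theorem net_level {E : Type*} [NormedAddCommGroup E] [NormedSpace ℝ E] [FiniteDimensional ℝ E]
    (μ : ℝ) (hμ : 0 ≤ μ) (j : ℕ) : ∃ s : Finset E, s.Nonempty ∧ (∀ c ∈ s, ‖c‖ ≤ 1) ∧
      (∀ x : E, ‖x‖ ≤ 1 → ∃ c ∈ s, μ * ‖x - c‖ ≤ (1 / 2) ^ (j + 1) / 2) ∧
      Real.log (s.card : ℝ) ≤ Module.finrank ℝ E * (j + 1 + Real.log (1 + 4 * μ)) := by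
  have hr : (0:ℝ) < 2 / (2 ^ (j + 1) * (4 * μ + 1 / 2)) := by positivity
  obtain ⟨s, h1, h2, h3, h4⟩ := exists_net (E := E) _ hr
  refine ⟨s, h1, h2, fun x hx => ?_, ?_⟩
  · obtain ⟨c, hc, hxc⟩ := h3 x hx
    refine ⟨c, hc, (mul_le_mul_of_nonneg_left hxc hμ).trans ?_⟩
    rw [show (1 / 2 : ℝ) ^ (j + 1) = (2 ^ (j + 1))⁻¹ by rw [one_div, inv_pow]]
    rw [mul_div_assoc', div_le_div_iff₀ (by positivity) (by positivity)]
    have : (0:ℝ) < 2 ^ (j + 1) := by positivity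
    have e : ((2:ℝ) ^ (j + 1))⁻¹ * (2 ^ (j + 1) * (4 * μ + 1 / 2)) = 4 * μ + 1 / 2 := by
      field_simp
    rw [e]; linarith
  · have hc : (0:ℝ) < s.card := by exact_mod_cast h1.card_pos
    have h5 : 1 + 2 / (2 / (2 ^ (j + 1) * (4 * μ + 1 / 2))) ≤ 2 ^ (j + 1) * (1 + 4 * μ) := by
      have e : 2 / (2 / (2 ^ (j + 1) * (4 * μ + 1 / 2))) = 2 ^ (j + 1) * (4 * μ + 1 / 2) := by
        field_simp
      rw [e]
      have : (1:ℝ) ≤ 2 ^ j := one_le_pow₀ (by norm_num)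
      rw [pow_succ]; nlinarith
    calc Real.log (s.card : ℝ) ≤ Real.log ((2 ^ (j + 1) * (1 + 4 * μ)) ^ Module.finrank ℝ E) :=
          Real.log_le_log hc (h4.trans (pow_le_pow_left₀ (by positivity) h5 _))
      _ = Module.finrank ℝ E * ((j + 1) * Real.log 2 + Real.log (1 + 4 * μ)) := by
          rw [Real.log_pow, Real.log_mul (by positivity) (by positivity), Real.log_pow]
          push_cast; ring
      _ ≤ _ := by
          have : Real.log 2 ≤ 1 := by linarith [Real.log_two_lt_d9]
          have h6 : ((j:ℝ) + 1) * Real.log 2 ≤ (j + 1) * 1 :=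
            mul_le_mul_of_nonneg_left this (by positivity)
          gcongr
          linarith

theorem chaining {m : ℕ} {E F : Type*} [NormedAddCommGroup E] [NormedSpace ℝ E]
    [FiniteDimensional ℝ E] [NormedAddCommGroup F] [NormedSpace ℝ F] [FiniteDimensional ℝ F]
    (v : E × F → Fin m → ℝ) (R μ κ : ℝ) (hR : 0 < R) (hμ : 0 ≤ μ) (hκ : 0 ≤ κ)
    (hLip : ∀ p q : E × F, ‖p.1‖ ≤ 1 → ‖p.2‖ ≤ 1 → ‖q.1‖ ≤ 1 → ‖q.2‖ ≤ 1 →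
      ∑ i, (v p i - v q i) ^ 2 ≤ (R * (μ * ‖p.1 - q.1‖ + κ * ‖p.2 - q.2‖)) ^ 2)
    (hB : ∀ p : E × F, ‖p.1‖ ≤ 1 → ‖p.2‖ ≤ 1 → ∑ i, v p i ^ 2 ≤ R ^ 2)
    (T : Finset (E × F)) (hT : T.Nonempty) (hTb : ∀ p ∈ T, ‖p.1‖ ≤ 1 ∧ ‖p.2‖ ≤ 1) :
    radW T hT v ≤ 2 * Real.sqrt 2 * R *
      (Real.sqrt (Module.finrank ℝ E) * Real.sqrt (2 + Real.log (1 + 4 * μ)) +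
       Real.sqrt (Module.finrank ℝ F) * Real.sqrt (2 + Real.log (1 + 4 * κ))) := by
  classical
  choose s1 hs1 hs1b hs1c hs1n using fun j => net_level (E := E) μ hμ j
  choose s2 hs2 hs2b hs2c hs2n using fun j => net_level (E := F) κ hκ j
  set d1 : ℝ := ((Module.finrank ℝ E : ℕ) : ℝ) with hd1
  set d2 : ℝ := ((Module.finrank ℝ F : ℕ) : ℝ) with hd2
  set a1 := Real.log (1 + 4 * μ) with ha1
  set a2 := Real.log (1 + 4 * κ) with ha2
  have a10 : 0 ≤ a1 := Real.log_nonneg (by linarith)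
  have a20 : 0 ≤ a2 := Real.log_nonneg (by linarith)
  have d10 : 0 ≤ d1 := by positivity
  have d20 : 0 ≤ d2 := by positivity
  let N : ℕ → Finset (E × F) := fun j => s1 j ×ˢ s2 j
  have hN : ∀ j, (N j).Nonempty := fun j => (hs1 j).product (hs2 j)
  have hNb : ∀ j, ∀ p ∈ N j, ‖p.1‖ ≤ 1 ∧ ‖p.2‖ ≤ 1 := by
    intro j p hp
    obtain ⟨h1, h2⟩ := Finset.mem_product.1 hp
    exact ⟨hs1b j _ h1, hs2b j _ h2⟩
  let B : ℕ → ℝ := fun j => d1 * (j + 1 + a1) + d2 * (j + 1 + a2)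
  have hB0 : ∀ j, 0 ≤ B j := fun j => by simp only [B]; positivity
  have hNc : ∀ j, Real.log (N j).card ≤ B j := by
    intro j
    have h1 : ((s1 j).card : ℝ) ≠ 0 := by exact_mod_cast (hs1 j).card_pos.ne'
    have h2 : ((s2 j).card : ℝ) ≠ 0 := by exact_mod_cast (hs2 j).card_pos.ne'
    simp only [N, Finset.card_product, Nat.cast_mul]
    rw [Real.log_mul h1 h2]
    exact add_le_add (hs1n j) (hs2n j)
  have hπ : ∀ j, ∀ p : E × F, ∃ q : E × F, ‖p.1‖ ≤ 1 → ‖p.2‖ ≤ 1 →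
      q ∈ N j ∧ ∑ i, (v p i - v q i) ^ 2 ≤ (R * (1 / 2) ^ (j + 1)) ^ 2 := by
    intro j p
    by_cases h1 : ‖p.1‖ ≤ 1
    · by_cases h2 : ‖p.2‖ ≤ 1
      · obtain ⟨c, hc, hpc⟩ := hs1c j p.1 h1
        obtain ⟨d, hd, hpd⟩ := hs2c j p.2 h2
        refine ⟨(c, d), fun _ _ => ⟨Finset.mem_product.2 ⟨hc, hd⟩, ?_⟩⟩
        refine (hLip p (c, d) h1 h2 (hs1b j c hc) (hs2b j d hd)).trans ?_
        apply pow_le_pow_left₀ (by positivity)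
        apply mul_le_mul_of_nonneg_left _ hR.le
        simp only; linarith
      · exact ⟨p, fun _ h => absurd h h2⟩
    · exact ⟨p, fun h => absurd h h1⟩
  choose π hπ using hπ
  let b : ℕ → ℝ := fun i => R * (1 / 2) ^ i * Real.sqrt (2 * B i)
  have hU : ∀ j, radW (N j) (hN j) v ≤ ∑ i ∈ Finset.range (j + 1), b i := by
    intro j
    induction j with
    | zero =>
      have := radW_massart (N 0) (hN 0) v R (B 0) hR (hB0 0)
        (fun p hp => hB p (hNb 0 p hp).1 (hNb 0 p hp).2) (hNc 0)
      simpa [b] using this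
    | succ j ih =>
      rw [Finset.sum_range_succ]
      refine (radW_step (N (j+1)) (N j) (hN _) (hN j) v (π j)
        (fun p hp => (hπ j p (hNb _ p hp).1 (hNb _ p hp).2).1)).trans (add_le_add ih ?_)
      exact radW_massart _ _ _ _ (B (j+1)) (by positivity) (hB0 _)
        (fun p hp => (hπ j p (hNb _ p hp).1 (hNb _ p hp).2).2) (hNc _)
  have hb : ∀ i, b i ≤ R * Real.sqrt 2 * (Real.sqrt d1 * ((1 / 2) ^ i * Real.sqrt (i + 1 + a1)) +
      Real.sqrt d2 * ((1 / 2) ^ i * Real.sqrt (i + 1 + a2))) := by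
    intro i
    have h1 : Real.sqrt (2 * B i) ≤ Real.sqrt 2 * (Real.sqrt d1 * Real.sqrt (i + 1 + a1) +
        Real.sqrt d2 * Real.sqrt (i + 1 + a2)) := by
      rw [Real.sqrt_mul (by norm_num)]
      apply mul_le_mul_of_nonneg_left _ (Real.sqrt_nonneg _)
      rw [← Real.sqrt_mul d10, ← Real.sqrt_mul d20]
      exact sqrt_add_le' _ _ (by positivity) (by positivity)
    have h2 := mul_le_mul_of_nonneg_left h1 (show 0 ≤ R * (1 / 2 : ℝ) ^ i by positivity)
    refine h2.trans (le_of_eq ?_)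
    ring
  have hS : ∀ j, ∑ i ∈ Finset.range (j + 1), b i ≤ 2 * Real.sqrt 2 * R *
      (Real.sqrt d1 * Real.sqrt (2 + a1) + Real.sqrt d2 * Real.sqrt (2 + a2)) := by
    intro j
    refine (Finset.sum_le_sum fun i _ => hb i).trans ?_
    rw [← Finset.mul_sum, Finset.sum_add_distrib, ← Finset.mul_sum, ← Finset.mul_sum]
    have h1 := mul_le_mul_of_nonneg_left (sqrt_sum (j+1) a1 a10) (Real.sqrt_nonneg d1)
    have h2 := mul_le_mul_of_nonneg_left (sqrt_sum (j+1) a2 a20) (Real.sqrt_nonneg d2)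
    refine (mul_le_mul_of_nonneg_left (add_le_add h1 h2)
      (show 0 ≤ R * Real.sqrt 2 by positivity)).trans (le_of_eq ?_)
    ring
  have hfin : ∀ j : ℕ, radW T hT v ≤ 2 * Real.sqrt 2 * R *
      (Real.sqrt d1 * Real.sqrt (2 + a1) + Real.sqrt d2 * Real.sqrt (2 + a2))
      + Real.sqrt m * (R * (1 / 2) ^ (j + 1)) := by
    intro j
    refine (radW_step T (N j) hT (hN j) v (π j)
        (fun p hp => (hπ j p (hTb p hp).1 (hTb p hp).2).1)).trans
        (add_le_add ((hU j).trans (hS j)) ?_)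
    exact radW_crude _ _ _ _ (by positivity) (fun p hp => (hπ j p (hTb p hp).1 (hTb p hp).2).2)
  have hlim : Filter.Tendsto (fun j : ℕ => 2 * Real.sqrt 2 * R *
      (Real.sqrt d1 * Real.sqrt (2 + a1) + Real.sqrt d2 * Real.sqrt (2 + a2))
      + Real.sqrt m * (R * (1 / 2) ^ (j + 1))) Filter.atTop (nhds (2 * Real.sqrt 2 * R *
      (Real.sqrt d1 * Real.sqrt (2 + a1) + Real.sqrt d2 * Real.sqrt (2 + a2))
      + Real.sqrt m * (R * 0))) := by
    have h0 : Filter.Tendsto (fun j : ℕ => (1 / 2 : ℝ) ^ (j + 1)) Filter.atTop (nhds 0) :=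
      (tendsto_pow_atTop_nhds_zero_of_lt_one (by norm_num) (by norm_num)).comp
        (Filter.tendsto_add_atTop_nat 1)
    exact ((h0.const_mul R).const_mul _).const_add _
  have := ge_of_tendsto' hlim hfin
  simpa using this

theorem integrable_of_bdd {Ω : Type*} [MeasurableSpace Ω] (μ : Measure Ω) [IsFiniteMeasure μ]
    (g : Ω → ℝ) (hg : Measurable g) (C : ℝ) (hC : ∀ x, |g x| ≤ C) : Integrable g μ :=
  Integrable.of_bound hg.aestronglyMeasurable C (Filter.Eventually.of_forall hC)

theorem integrable_exp_of_bdd {Ω : Type*} [MeasurableSpace Ω] (μ : Measure Ω) [IsFiniteMeasure μ]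
    (g : Ω → ℝ) (hg : Measurable g) (C t : ℝ) (hC : ∀ x, |g x| ≤ C) :
    Integrable (fun x => Real.exp (t * g x)) μ := by
  refine integrable_of_bdd μ _ (by fun_prop) (Real.exp (|t| * C)) fun x => ?_
  rw [Real.abs_exp, Real.exp_le_exp]
  calc t * g x ≤ |t * g x| := le_abs_self _
    _ = |t| * |g x| := abs_mul _ _
    _ ≤ _ := mul_le_mul_of_nonneg_left (hC x) (abs_nonneg _)

theorem hoeff {Ω : Type*} [MeasurableSpace Ω] (D : Measure Ω) [IsProbabilityMeasure D]
    (g : Ω → ℝ) (hg : Measurable g) (b t : ℝ) (hb : 0 ≤ b) (h : ∀ x y, |g x - g y| ≤ b) :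
    ∫ x, Real.exp (t * g x) ∂D ≤ Real.exp (t * ∫ x, g x ∂D + t ^ 2 * b ^ 2 / 2) := by
  obtain ⟨x0⟩ : Nonempty Ω := nonempty_of_isProbabilityMeasure D
  have h1 := ProbabilityTheory.hasSubgaussianMGF_of_mem_Icc (μ := D) (X := g) (a := g x0 - b)
    (b := g x0 + b) hg.aemeasurable (Filter.Eventually.of_forall fun x => by
      have := abs_le.1 (h x x0); constructor <;> linarith)
  have h2 := h1.mgf_le t
  have e : (((‖g x0 + b - (g x0 - b)‖₊ / 2) ^ 2 : NNReal) : ℝ) = b ^ 2 := by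
    push_cast
    rw [show g x0 + b - (g x0 - b) = 2 * b by ring, Real.norm_of_nonneg (by positivity)]
    ring
  rw [e, ProbabilityTheory.mgf] at h2
  have e2 : ∫ x, Real.exp (t * g x) ∂D
      = Real.exp (t * ∫ x, g x ∂D) * ∫ x, Real.exp (t * (g x - ∫ x, g x ∂D)) ∂D := by
    rw [← integral_const_mul]
    congr 1; ext x; rw [← Real.exp_add]; ring_nf
  rw [e2, Real.exp_add]
  refine mul_le_mul_of_nonneg_left (h2.trans (le_of_eq ?_)) (Real.exp_pos _).le
  ring_nf

theorem mcdiarmid {Ω : Type*} [MeasurableSpace Ω] (D : Measure Ω) [IsProbabilityMeasure D]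
    (b t : ℝ) (hb : 0 ≤ b) (m : ℕ) : ∀ (F : (Fin m → Ω) → ℝ), Measurable F →
    ∀ C : ℝ, (∀ x, |F x| ≤ C) →
    (∀ x y i, (∀ j, j ≠ i → x j = y j) → |F x - F y| ≤ b) →
    ∫ x, Real.exp (t * F x) ∂(Measure.pi fun _ : Fin m => D)
      ≤ Real.exp (t * (∫ x, F x ∂(Measure.pi fun _ : Fin m => D)) + m * (t ^ 2 * b ^ 2 / 2)) := by
  induction m with
  | zero =>
    intro F hF C hC hd
    have hc : ∀ x, F x = F (fun i => i.elim0) := fun x => by congr 1; ext i; exact i.elim0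
    have e1 : F = fun _ => F (fun i => i.elim0) := funext hc
    rw [e1]
    simp
  | succ m ih =>
    intro F hF C hC hd
    have mp := (measurePreserving_piFinSuccAbove (fun _ : Fin (m + 1) => D) 0).symm
    set e := (MeasurableEquiv.piFinSuccAbove (fun _ : Fin (m + 1) => Ω) 0).symm with he
    have hG : Measurable (fun z => F (e z)) := hF.comp e.measurable
    have key : ∀ f : (Fin (m + 1) → Ω) → ℝ, Measurable f → (∃ C, ∀ x, |f x| ≤ C) →
        ∫ x, f x ∂(Measure.pi fun _ : Fin (m + 1) => D)
          = ∫ a, ∫ y, f (e (a, y)) ∂(Measure.pi fun _ : Fin m => D) ∂D := by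
      rintro f hf ⟨C', hC'⟩
      rw [← mp.integral_comp' (g := f)]
      exact integral_prod _ (integrable_of_bdd _ _ (hf.comp e.measurable) C' fun x => hC' _)
    rw [key F hF ⟨C, hC⟩, key (fun x => Real.exp (t * F x)) (by fun_prop)
      ⟨Real.exp (|t| * C), fun x => by
        rw [Real.abs_exp, Real.exp_le_exp]
        calc t * F x ≤ |t * F x| := le_abs_self _
          _ = |t| * |F x| := abs_mul _ _
          _ ≤ _ := mul_le_mul_of_nonneg_left (hC x) (abs_nonneg _)⟩]
    have es : ∀ a y, e (a, y) = Fin.cons a y := by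
      intro a y
      simp [he, MeasurableEquiv.piFinSuccAbove, Fin.insertNthEquiv]
    let g : Ω → ℝ := fun a => ∫ y, F (e (a, y)) ∂(Measure.pi fun _ : Fin m => D)
    have hgm : Measurable g := (hG.stronglyMeasurable.integral_prod_right').measurable
    have hFa : ∀ a, Measurable (fun y => F (e (a, y))) := fun a => hG.comp measurable_prodMk_left
    have hFi : ∀ a, Integrable (fun y => F (e (a, y))) (Measure.pi fun _ : Fin m => D) :=
      fun a => integrable_of_bdd _ _ (hFa a) C fun _ => hC _
    have hgC : ∀ a, |g a| ≤ C := fun a => by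
      have := norm_integral_le_of_norm_le_const (μ := Measure.pi fun _ : Fin m => D)
        (f := fun y => F (e (a, y))) (C := C) (Filter.Eventually.of_forall fun y => hC _)
      simpa using this
    have hgd : ∀ a a', |g a - g a'| ≤ b := fun a a' => by
      have e3 : g a - g a' = ∫ y, (F (e (a, y)) - F (e (a', y)))
          ∂(Measure.pi fun _ : Fin m => D) := (integral_sub (hFi a) (hFi a')).symm
      rw [e3]
      have := norm_integral_le_of_norm_le_const (μ := Measure.pi fun _ : Fin m => D)
        (f := fun y => F (e (a, y)) - F (e (a', y))) (C := b)
        (Filter.Eventually.of_forall fun y => hd _ _ 0 fun j hj => by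
          rw [es, es]
          obtain ⟨k, rfl⟩ := Fin.exists_succ_eq.2 hj
          simp)
      simpa using this
    have hin : ∀ a, ∫ y, Real.exp (t * F (e (a, y))) ∂(Measure.pi fun _ : Fin m => D)
        ≤ Real.exp (t * g a) * Real.exp (m * (t ^ 2 * b ^ 2 / 2)) := fun a => by
      rw [← Real.exp_add]
      refine ih (fun y => F (e (a, y))) (hFa a) C (fun _ => hC _) fun x y i hxy => ?_
      refine hd _ _ i.succ fun j hj => ?_
      rw [es, es]
      refine Fin.cases ?_ (fun k => ?_) j hj
      · intro _; simp
      · intro hk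
        simp only [Fin.cons_succ]
        exact hxy k fun h => hk (by rw [h])
    have hexpm : Measurable (fun z => Real.exp (t * F (e z))) := by fun_prop
    calc _ ≤ ∫ a, Real.exp (t * g a) * Real.exp (m * (t ^ 2 * b ^ 2 / 2)) ∂D := by
          refine integral_mono_of_nonneg (Filter.Eventually.of_forall fun a =>
            integral_nonneg fun y => (Real.exp_pos _).le) ?_ (Filter.Eventually.of_forall hin)
          exact (integrable_exp_of_bdd D g hgm C t hgC).mul_const _
      _ = (∫ a, Real.exp (t * g a) ∂D) * Real.exp (m * (t ^ 2 * b ^ 2 / 2)) :=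
          integral_mul_const _ _
      _ ≤ Real.exp (t * ∫ x, g x ∂D + t ^ 2 * b ^ 2 / 2) * Real.exp (m * (t ^ 2 * b ^ 2 / 2)) :=
          mul_le_mul_of_nonneg_right (hoeff D g hgm b t hb hgd) (Real.exp_pos _).le
      _ = _ := by
          rw [← Real.exp_add]; congr 1; push_cast; ring

theorem sup'_abs_le {ι : Type*} (T : Finset ι) (hT : T.Nonempty) (f : ι → ℝ) (C : ℝ)
    (h : ∀ p ∈ T, |f p| ≤ C) : |T.sup' hT f| ≤ C := by
  obtain ⟨p, hp, e⟩ := Finset.exists_mem_eq_sup' hT f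
  rw [e]; exact h p hp

theorem sup'_sub_le {ι : Type*} (T : Finset ι) (hT : T.Nonempty) (f g : ι → ℝ) (C : ℝ)
    (h : ∀ p ∈ T, |f p - g p| ≤ C) : |T.sup' hT f - T.sup' hT g| ≤ C := by
  have key : ∀ f g : ι → ℝ, (∀ p ∈ T, f p - g p ≤ C) → T.sup' hT f - T.sup' hT g ≤ C := by
    intro f g h
    rw [sub_le_iff_le_add]
    refine Finset.sup'_le _ _ fun p hp => ?_
    have := Finset.le_sup' g hp
    have := h p hp
    linarith
  rw [abs_le]
  refine ⟨?_, key f g fun p hp => (abs_le.1 (h p hp)).2⟩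
  have := key g f fun p hp => by have := (abs_le.1 (h p hp)).1; linarith
  linarith

theorem sum_abs_le {m : ℕ} (f : Fin m → ℝ) (C : ℝ) (h : ∀ i, |f i| ≤ C) : |∑ i, f i| ≤ m * C := by
  refine (Finset.abs_sum_le_sum_abs _ _).trans ((Finset.sum_le_sum fun i _ => h i).trans ?_)
  simp

theorem measurable_sup'_real {Ω ι : Type*} [MeasurableSpace Ω] (T : Finset ι) (hT : T.Nonempty)
    (f : ι → Ω → ℝ) (h : ∀ p, Measurable (f p)) :
    Measurable (fun x => T.sup' hT (fun p => f p x)) := by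
  have := Finset.measurable_sup' hT (f := f) fun p _ => h p
  convert this using 1
  ext x
  rw [Finset.sup'_apply]

section symmetrization
variable {Ω ι : Type*} [MeasurableSpace Ω] {m : ℕ}

theorem swap_invariance (D : Measure Ω) [IsProbabilityMeasure D] (e : Fin m → Bool)
    (J : (Fin m → Ω) → (Fin m → Ω) → ℝ) (J' : (Fin m → Ω) → (Fin m → Ω) → ℝ)
    (hJ : ∀ X X', J' X X' = J (fun i => if e i then X i else X' i)
      (fun i => if e i then X' i else X i))
    (hm : Measurable (fun z : (Fin m → Ω) × (Fin m → Ω) => J z.1 z.2)) :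
    ∫ z, J' z.1 z.2 ∂((Measure.pi fun _ : Fin m => D).prod (Measure.pi fun _ : Fin m => D))
    = ∫ z, J z.1 z.2 ∂((Measure.pi fun _ : Fin m => D).prod (Measure.pi fun _ : Fin m => D)) := by
  have mp := measurePreserving_arrowProdEquivProdArrow Ω Ω (Fin m) (fun _ => D) (fun _ => D)
  rw [← mp.integral_comp' (g := fun z => J z.1 z.2), ← mp.integral_comp' (g := fun z => J' z.1 z.2)]
  let f : Fin m → Ω × Ω → Ω × Ω := fun i => if e i then id else Prod.swap
  have hf : ∀ i, MeasurePreserving (f i) (D.prod D) (D.prod D) := by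
    intro i
    by_cases h : e i
    · simp only [f, h, if_true]; exact MeasurePreserving.id _
    · simp only [f, h]; exact Measure.measurePreserving_swap
  have hpi : (Measure.pi fun _ : Fin m => D.prod D).map (fun x i => f i (x i))
      = Measure.pi fun _ : Fin m => D.prod D := by
    have : ∀ i, SigmaFinite ((D.prod D).map (f i)) := fun i => by
      rw [(hf i).map_eq]; infer_instance
    rw [Measure.pi_map_pi (fun i => (hf i).measurable.aemeasurable)]
    congr 1; ext1 i; exact (hf i).map_eq
  have hmeas : Measurable (fun (x : Fin m → Ω × Ω) i => f i (x i)) :=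
    measurable_pi_lambda _ fun i => (hf i).measurable.comp (measurable_pi_apply i)
  conv_rhs => rw [← hpi]
  have hm2 : Measurable (fun x : Fin m → Ω × Ω =>
      J ((MeasurableEquiv.arrowProdEquivProdArrow Ω Ω (Fin m)) x).1
        ((MeasurableEquiv.arrowProdEquivProdArrow Ω Ω (Fin m)) x).2) :=
    hm.comp (MeasurableEquiv.measurable _)
  rw [integral_map hmeas.aemeasurable hm2.aestronglyMeasurable]
  congr 1
  ext z
  simp only [MeasurableEquiv.arrowProdEquivProdArrow, Equiv.arrowProdEquivProdArrow,
    MeasurableEquiv.coe_mk, Equiv.coe_fn_mk, hJ]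
  congr 1
  · ext i; by_cases h : e i <;> simp [f, h]
  · ext i; by_cases h : e i <;> simp [f, h]

theorem radW_measurable (T : Finset ι) (hT : T.Nonempty) (l : ι → Ω → ℝ)
    (hl : ∀ p, Measurable (l p)) :
    Measurable (fun X : Fin m → Ω => radW T hT (fun p i => l p (X i))) := by
  unfold radW
  refine Measurable.const_mul (Finset.measurable_sum _ fun e _ => ?_) _
  refine measurable_sup'_real T hT (fun p (X : Fin m → Ω) => ∑ i, sg (e i) * l p (X i)) fun p => ?_
  exact Finset.measurable_sum _ fun i _ => ((hl p).comp (measurable_pi_apply i)).const_mul _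

theorem symmetrization (D : Measure Ω) [IsProbabilityMeasure D]
    (T : Finset ι) (hT : T.Nonempty) (l : ι → Ω → ℝ)
    (hl : ∀ p, Measurable (l p)) (C : ℝ) (hC : ∀ p x, |l p x| ≤ C) :
    ∫ X, T.sup' hT (fun p => ∑ i, ((∫ x, l p x ∂D) - l p (X i))) ∂(Measure.pi fun _ : Fin m => D)
      ≤ 2 * ∫ X, radW T hT (fun p i => l p (X i)) ∂(Measure.pi fun _ : Fin m => D) := by
  set Q := Measure.pi fun _ : Fin m => D with hQ
  have hlm : ∀ p (i : Fin m), Measurable fun X : Fin m → Ω => l p (X i) :=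
    fun p i => (hl p).comp (measurable_pi_apply i)
  have hC0 : 0 ≤ C := by
    obtain ⟨x0⟩ : Nonempty Ω := nonempty_of_isProbabilityMeasure D
    obtain ⟨p, hp⟩ := hT
    exact (abs_nonneg _).trans (hC p x0)
  let J : (Fin m → Bool) → (Fin m → Ω) → (Fin m → Ω) → ℝ :=
    fun e X X' => T.sup' hT (fun p => ∑ i, sg (e i) * (l p (X' i) - l p (X i)))
  have hJm : ∀ e, Measurable (fun z : (Fin m → Ω) × (Fin m → Ω) => J e z.1 z.2) := by
    intro e
    refine measurable_sup'_real T hT (fun p (z : (Fin m → Ω) × (Fin m → Ω)) =>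
      ∑ i, sg (e i) * (l p (z.2 i) - l p (z.1 i))) fun p => ?_
    refine Finset.measurable_sum _ fun i _ => Measurable.const_mul ?_ _
    exact ((hlm p i).comp measurable_snd).sub ((hlm p i).comp measurable_fst)
  have hJb : ∀ e X X', |J e X X'| ≤ m * (2 * C) := by
    intro e X X'
    refine sup'_abs_le _ _ _ _ fun p _ => sum_abs_le _ _ fun i => ?_
    rw [abs_mul, abs_sg, one_mul]
    have h1 := hC p (X' i)
    have h2 := hC p (X i)
    exact (abs_sub _ _).trans (by linarith)
  have hJi : ∀ e, Integrable (fun z : (Fin m → Ω) × (Fin m → Ω) => J e z.1 z.2) (Q.prod Q) :=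
    fun e => integrable_of_bdd _ _ (hJm e) _ fun z => hJb e _ _
  let S : (Fin m → Bool) → (Fin m → Ω) → ℝ :=
    fun e X => T.sup' hT (fun p => ∑ i, sg (e i) * l p (X i))
  have hSm : ∀ e, Measurable (S e) := by
    intro e
    refine measurable_sup'_real T hT (fun p (X : Fin m → Ω) => ∑ i, sg (e i) * l p (X i))
      fun p => ?_
    exact Finset.measurable_sum _ fun i _ => (hlm p i).const_mul _
  have hSb : ∀ e X, |S e X| ≤ m * C := by
    intro e X
    refine sup'_abs_le _ _ _ _ fun p _ => sum_abs_le _ _ fun i => ?_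
    rw [abs_mul, abs_sg, one_mul]
    exact hC _ _
  have hSi : ∀ e, Integrable (S e) Q := fun e => integrable_of_bdd _ _ (hSm e) _ (hSb e)
  let tt : Fin m → Bool := fun _ => true
  let neg : (Fin m → Bool) ≃ (Fin m → Bool) :=
      { toFun := fun e i => !(e i), invFun := fun e i => !(e i)
        left_inv := fun e => by ext; simp
        right_inv := fun e => by ext; simp }
  have hJX : ∀ X, Measurable (fun X' => J tt X X') := by
    intro X
    refine measurable_sup'_real T hT (fun p (X' : Fin m → Ω) =>
      ∑ i, sg (tt i) * (l p (X' i) - l p (X i))) fun p => ?_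
    exact Finset.measurable_sum _ fun i _ =>
      Measurable.const_mul ((hlm p i).sub measurable_const) _
  have s1 : ∫ X, T.sup' hT (fun p => ∑ i, ((∫ x, l p x ∂D) - l p (X i))) ∂Q
      ≤ ∫ X, ∫ X', J tt X X' ∂Q ∂Q := by
    refine integral_mono ?_ (hJi tt).integral_prod_left ?_
    · refine integrable_of_bdd _ _ ?_ (m * (2 * C)) ?_
      · refine measurable_sup'_real T hT (fun p (X : Fin m → Ω) =>
          ∑ i, ((∫ x, l p x ∂D) - l p (X i))) fun p => ?_
        exact Finset.measurable_sum _ fun i _ => measurable_const.sub (hlm p i)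
      · intro X
        refine sup'_abs_le _ _ _ _ fun p _ => sum_abs_le _ _ fun i => ?_
        have h1 : |∫ x, l p x ∂D| ≤ C := by
          have := norm_integral_le_of_norm_le_const (μ := D)
            (f := l p) (C := C) (Filter.Eventually.of_forall fun y => hC p y)
          simpa using this
        have h2 := hC p (X i)
        exact (abs_sub _ _).trans (by linarith)
    · intro X
      refine Finset.sup'_le _ _ fun p hp => ?_
      have hev : ∀ i : Fin m, ∫ X' : Fin m → Ω, l p (X' i) ∂Q = ∫ x, l p x ∂D := fun i =>
        integral_comp_eval (μ := fun _ : Fin m => D) (i := i) (hl p).aestronglyMeasurable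
      have hli : ∀ i : Fin m, Integrable (fun X' : Fin m → Ω => l p (X' i)) Q := fun i =>
        integrable_of_bdd _ _ (hlm p i) C fun _ => hC _ _
      have hli2 : ∀ i : Fin m, Integrable (fun X' : Fin m → Ω => l p (X' i) - l p (X i)) Q :=
        fun i => (hli i).sub (integrable_const _)
      have hJ2 : Integrable (fun X' => J tt X X') Q :=
        integrable_of_bdd _ _ (hJX X) _ fun X' => hJb tt X X'
      have e1 : ∑ i, ((∫ x, l p x ∂D) - l p (X i))
          = ∫ X', ∑ i, (l p (X' i) - l p (X i)) ∂Q := by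
        rw [integral_finsetSum _ fun i _ => hli2 i]
        refine Finset.sum_congr rfl fun i _ => ?_
        rw [integral_sub (hli i) (integrable_const _), hev i]
        simp
      rw [e1]
      refine integral_mono (integrable_finsetSum _ fun i _ => hli2 i) hJ2 ?_
      intro X'
      have := Finset.le_sup' (fun p => ∑ i, sg (tt i) * (l p (X' i) - l p (X i))) hp
      refine le_of_eq_of_le ?_ this
      simp only [tt, sg, if_true, one_mul]
  have s2 : ∫ X, ∫ X', J tt X X' ∂Q ∂Q = ∫ z, J tt z.1 z.2 ∂(Q.prod Q) :=
    (integral_prod _ (hJi tt)).symm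
  have s3 : ∀ e, ∫ z, J tt z.1 z.2 ∂(Q.prod Q) = ∫ z, J e z.1 z.2 ∂(Q.prod Q) := by
    intro e
    refine (swap_invariance D e (J tt) (J e) ?_ (hJm tt)).symm
    intro X X'
    simp only [J]
    congr 1; ext p
    refine Finset.sum_congr rfl fun i _ => ?_
    cases h : e i <;> simp [sg, tt]
  have s4 : ∀ e, ∫ z, J e z.1 z.2 ∂(Q.prod Q) ≤ ∫ X, S e X ∂Q + ∫ X, S (neg e) X ∂Q := by
    intro e
    have i1 : Integrable (fun z : (Fin m → Ω) × (Fin m → Ω) => S e z.2) (Q.prod Q) :=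
      integrable_of_bdd _ _ ((hSm e).comp measurable_snd) _ fun z => hSb e _
    have i2 : Integrable (fun z : (Fin m → Ω) × (Fin m → Ω) => S (neg e) z.1) (Q.prod Q) :=
      integrable_of_bdd _ _ ((hSm _).comp measurable_fst) _ fun z => hSb _ _
    have e1 : ∫ z, S e z.2 ∂(Q.prod Q) = ∫ X, S e X ∂Q := by
      rw [integral_prod _ i1]; simp
    have e2 : ∫ z, S (neg e) z.1 ∂(Q.prod Q) = ∫ X, S (neg e) X ∂Q := by
      rw [integral_prod _ i2]; simp
    rw [← e1, ← e2, ← integral_add i1 i2]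
    refine integral_mono (hJi e) (i1.add i2) fun z => ?_
    refine Finset.sup'_le _ _ fun p hp => ?_
    have h1 := Finset.le_sup' (fun p => ∑ i, sg (e i) * l p (z.2 i)) hp
    have h2 := Finset.le_sup' (fun p => ∑ i, sg (neg e i) * l p (z.1 i)) hp
    have h3 : ∀ i, sg (neg e i) = - sg (e i) := fun i => sg_not _
    simp only [h3, neg_mul, Finset.sum_neg_distrib] at h2
    simp only [mul_sub, Finset.sum_sub_distrib, S, h3, neg_mul, Finset.sum_neg_distrib]
    linarith
  have s5 : ∫ X, radW T hT (fun p i => l p (X i)) ∂Q = (1 / 2 ^ m) * ∑ e, ∫ X, S e X ∂Q := by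
    unfold radW
    rw [integral_const_mul, integral_finsetSum _ fun e _ => hSi e]
  have s6 : ∑ e, ∫ X, S (neg e) X ∂Q = ∑ e, ∫ X, S e X ∂Q :=
    Equiv.sum_comp neg (fun e => ∫ X, S e X ∂Q)
  calc _ ≤ ∫ z, J tt z.1 z.2 ∂(Q.prod Q) := s1.trans s2.le
    _ = (1 / 2 ^ m) * ∑ _e : Fin m → Bool, ∫ z, J tt z.1 z.2 ∂(Q.prod Q) := (avg_const _).symm
    _ ≤ (1 / 2 ^ m) * ∑ e : Fin m → Bool, (∫ X, S e X ∂Q + ∫ X, S (neg e) X ∂Q) :=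
        avg_le fun e => (s3 e).trans_le (s4 e)
    _ = _ := by rw [Finset.sum_add_distrib, s6, s5]; ring

end symmetrization

theorem radW_diff {m : ℕ} {ι : Type*} (T : Finset ι) (hT : T.Nonempty) (w w' : ι → Fin m → ℝ)
    (C : ℝ) (h : ∀ p ∈ T, ∑ i, |w p i - w' p i| ≤ C) : |radW T hT w - radW T hT w'| ≤ C := by
  unfold radW
  rw [← mul_sub, ← Finset.sum_sub_distrib, abs_mul, abs_of_nonneg (by positivity)]
  refine (mul_le_mul_of_nonneg_left (Finset.abs_sum_le_sum_abs _ _) (by positivity)).trans ?_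
  refine (avg_le (g := fun _ => C) fun e => ?_).trans (avg_const _).le
  refine sup'_sub_le _ _ _ _ _ fun p hp => ?_
  rw [← Finset.sum_sub_distrib]
  refine (Finset.abs_sum_le_sum_abs _ _).trans (le_trans (le_of_eq ?_) (h p hp))
  refine Finset.sum_congr rfl fun i _ => ?_
  rw [← mul_sub, abs_mul, abs_sg, one_mul]

theorem radW_abs {m : ℕ} {ι : Type*} (T : Finset ι) (hT : T.Nonempty) (w : ι → Fin m → ℝ)
    (C : ℝ) (h : ∀ p ∈ T, ∀ i, |w p i| ≤ C) : |radW T hT w| ≤ m * C := by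
  unfold radW
  rw [abs_mul, abs_of_nonneg (by positivity)]
  refine (mul_le_mul_of_nonneg_left (Finset.abs_sum_le_sum_abs _ _) (by positivity)).trans ?_
  refine (avg_le (g := fun _ => m * C) fun e => ?_).trans (avg_const _).le
  refine sup'_abs_le _ _ _ _ fun p hp => sum_abs_le _ _ fun i => ?_
  rw [abs_mul, abs_sg, one_mul]
  exact h p hp i

theorem finite_class {Ω ι : Type*} [MeasurableSpace Ω] {m : ℕ} (hm : 0 < m)
    (D : Measure Ω) [IsProbabilityMeasure D]
    (T : Finset ι) (hT : T.Nonempty) (l : ι → Ω → ℝ)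
    (hl : ∀ p, Measurable (l p)) (c : ℝ) (hc : 0 < c) (h0 : ∀ p x, 0 ≤ l p x)
    (hC : ∀ p x, l p x ≤ c) (δ : ℝ) (hδ : 0 < δ) (hδ1 : δ < 1) :
    (Measure.pi fun _ : Fin m => D) {X | ∃ p ∈ T,
      (1 / (m : ℝ)) * ∑ i, l p (X i) + (2 / m) * radW T hT (fun p i => l p (X i))
        + 4 * c * Real.sqrt (2 * Real.log (4 / δ) / m) < ∫ x, l p x ∂D} ≤ ENNReal.ofReal δ := by
  set Q := Measure.pi fun _ : Fin m => D with hQ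
  have hm' : (0:ℝ) < m := by exact_mod_cast hm
  have habs : ∀ p x, |l p x| ≤ c := fun p x => abs_le.2 ⟨by linarith [h0 p x], hC p x⟩
  set s := Real.sqrt (2 * Real.log (4 / δ) / m) with hs
  have hlog : 0 < Real.log (4 / δ) := Real.log_pos (by rw [lt_div_iff₀ hδ]; linarith)
  have hss : s ^ 2 = 2 * Real.log (4 / δ) / m := Real.sq_sqrt (by positivity)
  let G : (Fin m → Ω) → ℝ := fun X => T.sup' hT (fun p => ∑ i, ((∫ x, l p x ∂D) - l p (X i)))
  let Rd : (Fin m → Ω) → ℝ := fun X => radW T hT (fun p i => l p (X i))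
  let F : (Fin m → Ω) → ℝ := fun X => G X - 2 * Rd X
  have hlm : ∀ p (i : Fin m), Measurable fun X : Fin m → Ω => l p (X i) :=
    fun p i => (hl p).comp (measurable_pi_apply i)
  have hRm : Measurable Rd := radW_measurable T hT l hl
  have hGm : Measurable G := by
    refine measurable_sup'_real T hT (fun p (X : Fin m → Ω) =>
          ∑ i, ((∫ x, l p x ∂D) - l p (X i))) fun p => ?_
    exact Finset.measurable_sum _ fun i _ => measurable_const.sub (hlm p i)
  have hGb : ∀ X, |G X| ≤ m * (2 * c) := by
    intro X
    refine sup'_abs_le _ _ _ _ fun p _ => sum_abs_le _ _ fun i => ?_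
    have h1 : |∫ x, l p x ∂D| ≤ c := by
      have := norm_integral_le_of_norm_le_const (μ := D)
        (f := l p) (C := c) (Filter.Eventually.of_forall fun y => habs p y)
      simpa using this
    have h2 := habs p (X i)
    exact (abs_sub _ _).trans (by linarith)
  have hRb : ∀ X, |Rd X| ≤ m * c := fun X => radW_abs _ _ _ _ fun p _ i => habs p _
  have hFm : Measurable F := hGm.sub (hRm.const_mul _)
  have hFb : ∀ X, |F X| ≤ m * (4 * c) := by
    intro X
    have h1 := abs_le.1 (hGb X)
    have h2 := abs_le.1 (hRb X)
    simp only [F]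
    rw [abs_le]
    constructor <;> linarith
  have hone : ∀ (X Y : Fin m → Ω) (i : Fin m), (∀ j, j ≠ i → X j = Y j) → ∀ p,
      ∑ j, |l p (X j) - l p (Y j)| ≤ c := by
    intro X Y i hXY p
    rw [Finset.sum_eq_single i]
    · rw [abs_le]
      constructor <;> linarith [h0 p (X i), h0 p (Y i), hC p (X i), hC p (Y i)]
    · intro j _ hj; rw [hXY j hj]; simp
    · simp
  have hFd : ∀ X Y i, (∀ j, j ≠ i → X j = Y j) → |F X - F Y| ≤ 3 * c := by
    intro X Y i hXY
    have h1 : |G X - G Y| ≤ c := by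
      refine sup'_sub_le _ _ _ _ _ fun p hp => ?_
      rw [← Finset.sum_sub_distrib]
      refine (Finset.abs_sum_le_sum_abs _ _).trans (le_trans (le_of_eq ?_) (hone Y X i
        (fun j hj => (hXY j hj).symm) p))
      refine Finset.sum_congr rfl fun j _ => ?_
      congr 1; ring
    have h2 : |Rd X - Rd Y| ≤ c := radW_diff _ _ _ _ _ fun p _ => hone X Y i hXY p
    have h1 := abs_le.1 h1
    have h2 := abs_le.1 h2
    simp only [F]
    rw [abs_le]
    constructor <;> linarith
  have hEF : ∫ X, F X ∂Q ≤ 0 := by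
    have hGi : Integrable G Q := integrable_of_bdd _ _ hGm _ hGb
    have hRi : Integrable Rd Q := integrable_of_bdd _ _ hRm _ hRb
    have e : ∫ X, F X ∂Q = ∫ X, G X ∂Q - 2 * ∫ X, Rd X ∂Q := by
      rw [← integral_const_mul]
      exact integral_sub hGi (hRi.const_mul _)
    have := symmetrization (m := m) D T hT l hl c habs
    rw [e]
    have h3 : ∫ X, G X ∂Q ≤ 2 * ∫ X, Rd X ∂Q := this
    linarith
  set u : ℝ := m * (4 * c * s) with hu
  set t : ℝ := 4 * s / (9 * c) with ht
  have hs0 : 0 ≤ s := Real.sqrt_nonneg _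
  have ht0 : 0 ≤ t := by positivity
  have hmcd := mcdiarmid D (3 * c) t (by positivity) m F hFm _ hFb hFd
  have hmcd2 : ∫ X, Real.exp (t * F X) ∂Q ≤ Real.exp (m * (t ^ 2 * (3 * c) ^ 2 / 2)) := by
    refine hmcd.trans (Real.exp_le_exp.2 ?_)
    have := mul_nonpos_of_nonneg_of_nonpos ht0 hEF
    linarith
  have hcheb := mul_meas_ge_le_integral_of_nonneg (μ := Q) (f := fun X => Real.exp (t * F X))
    (Filter.Eventually.of_forall fun X => (Real.exp_pos _).le)
    (integrable_exp_of_bdd Q F hFm _ t hFb) (Real.exp (t * u))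
  have hexp : Real.exp (m * (t ^ 2 * (3 * c) ^ 2 / 2)) ≤ δ * Real.exp (t * u) := by
    have e1 : δ * Real.exp (t * u) = Real.exp (Real.log δ + t * u) := by
      rw [Real.exp_add, Real.exp_log hδ]
    rw [e1, Real.exp_le_exp]
    have e2 : (m:ℝ) * (t ^ 2 * (3 * c) ^ 2 / 2) = 8 / 9 * (m * s ^ 2) := by
      rw [ht]; field_simp; ring
    have e3 : t * u = 16 / 9 * (m * s ^ 2) := by
      rw [ht, hu]; field_simp; ring
    have e4 : (m:ℝ) * s ^ 2 = 2 * Real.log (4 / δ) := by rw [hss]; field_simp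
    rw [e2, e3, e4]
    have e5 : Real.log (4 / δ) = Real.log 4 - Real.log δ := Real.log_div (by norm_num) hδ.ne'
    have e6 : 0 < Real.log 4 := Real.log_pos (by norm_num)
    have e7 : Real.log δ < 0 := Real.log_neg hδ hδ1
    rw [e5]; linarith
  have hprob : Q.real {X | Real.exp (t * u) ≤ Real.exp (t * F X)} ≤ δ := by
    have h1 := (hcheb.trans hmcd2).trans hexp
    have h2 := Real.exp_pos (t * u)
    rw [mul_comm] at h1
    exact le_of_mul_le_mul_right h1 h2
  have hsub : {X | ∃ p ∈ T,
      (1 / (m : ℝ)) * ∑ i, l p (X i) + (2 / m) * radW T hT (fun p i => l p (X i))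
        + 4 * c * s < ∫ x, l p x ∂D} ⊆ {X | Real.exp (t * u) ≤ Real.exp (t * F X)} := by
    rintro X ⟨p, hp, hX⟩
    simp only [Set.mem_ofPred_eq, Real.exp_le_exp]
    refine mul_le_mul_of_nonneg_left ?_ ht0
    have h1 : ∑ i, ((∫ x, l p x ∂D) - l p (X i)) ≤ G X :=
      Finset.le_sup' (fun p => ∑ i, ((∫ x, l p x ∂D) - l p (X i))) hp
    rw [Finset.sum_sub_distrib] at h1
    simp only [Finset.sum_const, Finset.card_univ, Fintype.card_fin, nsmul_eq_mul] at h1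
    have h2 := mul_lt_mul_of_pos_left hX hm'
    have h3 : (m:ℝ) * ((1 / (m : ℝ)) * ∑ i, l p (X i) + (2 / m) * radW T hT (fun p i => l p (X i))
        + 4 * c * s) = ∑ i, l p (X i) + 2 * Rd X + u := by
      simp only [Rd, hu]; field_simp
    rw [h3] at h2
    simp only [F]; linarith
  refine (measure_mono hsub).trans ?_
  rw [← ENNReal.ofReal_toReal (measure_ne_top Q _)]
  exact ENNReal.ofReal_le_ofReal hprob

theorem full_class {Ω P : Type*} [MeasurableSpace Ω] {m : ℕ} (hm : 0 < m)
    [TopologicalSpace P] [TopologicalSpace.SeparableSpace P] [FirstCountableTopology P] [Nonempty P]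
    (D : Measure Ω) [IsProbabilityMeasure D] (l : P → Ω → ℝ)
    (hl : ∀ p, Measurable (l p)) (hlc : ∀ x, Continuous fun p => l p x)
    (c : ℝ) (hc : 0 < c) (h0 : ∀ p x, 0 ≤ l p x)
    (hC : ∀ p x, l p x ≤ c) (δ : ℝ) (hδ : 0 < δ) (hδ1 : δ < 1) (g : (Fin m → Ω) → ℝ)
    (hg : ∀ (T : Finset P) (hT : T.Nonempty) (X : Fin m → Ω),
      (2 / m) * radW T hT (fun p i => l p (X i)) ≤ g X) :
    ENNReal.ofReal (1 - δ) ≤ (Measure.pi fun _ : Fin m => D) {X | ∀ p,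
      ∫ x, l p x ∂D ≤ (1 / (m : ℝ)) * ∑ i, l p (X i) + g X
        + 4 * c * Real.sqrt (2 * Real.log (4 / δ) / m)} := by
  classical
  set Q := Measure.pi fun _ : Fin m => D with hQ
  set u := 4 * c * Real.sqrt (2 * Real.log (4 / δ) / m) with hu
  let d : ℕ → P := TopologicalSpace.denseSeq P
  let bad : ℕ → Set (Fin m → Ω) := fun k => {X | ∃ p ∈ (Finset.range (k + 1)).image d,
    (1 / (m : ℝ)) * ∑ i, l p (X i) + g X + u < ∫ x, l p x ∂D}
  have hbad : ∀ k, Q (bad k) ≤ ENNReal.ofReal δ := by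
    intro k
    have hT : ((Finset.range (k + 1)).image d).Nonempty := by simp
    refine (measure_mono ?_).trans (finite_class hm D _ hT l hl c hc h0 hC δ hδ hδ1)
    rintro X ⟨p, hp, hX⟩
    refine ⟨p, hp, lt_of_le_of_lt ?_ hX⟩
    have := hg _ hT X
    linarith
  have hmono : Monotone bad := by
    intro k k' hkk X hX
    obtain ⟨p, hp, hX⟩ := hX
    refine ⟨p, ?_, hX⟩
    exact Finset.image_subset_image (Finset.range_mono (by omega)) hp
  have hU : Q (⋃ k, bad k) ≤ ENNReal.ofReal δ := by
    rw [hmono.measure_iUnion]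
    exact iSup_le hbad
  have hcompl : (⋃ k, bad k)ᶜ ⊆ {X | ∀ p,
      ∫ x, l p x ∂D ≤ (1 / (m : ℝ)) * ∑ i, l p (X i) + g X + u} := by
    intro X hX
    have hd : ∀ k, ∫ x, l (d k) x ∂D ≤ (1 / (m : ℝ)) * ∑ i, l (d k) (X i) + g X + u := by
      intro k
      by_contra! hcon
      refine hX (Set.mem_iUnion.2 ⟨k, d k, ?_, hcon⟩)
      exact Finset.mem_image_of_mem _ (by simp)
    have hc1 : Continuous fun p => ∫ x, l p x ∂D := by
      refine continuous_of_dominated (bound := fun _ => c)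
        (fun p => (hl p).aestronglyMeasurable) (fun p => Filter.Eventually.of_forall fun x => ?_)
        (integrable_const _) (Filter.Eventually.of_forall fun x => hlc x)
      rw [Real.norm_of_nonneg (h0 p x)]; exact hC p x
    have hc2 : Continuous fun p => (1 / (m : ℝ)) * ∑ i, l p (X i) + g X + u := by
      have := continuous_finsetSum Finset.univ fun (i : Fin m) _ => hlc (X i)
      fun_prop
    have hcl := isClosed_le hc1 hc2
    intro p
    exact (TopologicalSpace.denseRange_denseSeq P).induction_on (p := fun p =>
      ∫ x, l p x ∂D ≤ (1 / (m : ℝ)) * ∑ i, l p (X i) + g X + u) p hcl hd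
  have hone : (1 : ℝ≥0∞) ≤ Q (⋃ k, bad k) + Q (⋃ k, bad k)ᶜ := by
    rw [← measure_univ (μ := Q), ← Set.union_compl_self (⋃ k, bad k)]
    exact measure_union_le _ _
  rw [ENNReal.ofReal_sub _ hδ.le, ENNReal.ofReal_one, tsub_le_iff_left]
  exact hone.trans (add_le_add hU (measure_mono hcompl))

theorem soft_zero (mu : ℝ) : soft mu 0 = 0 := by simp [soft]

theorem soft_eq (mu x : ℝ) (hmu : 0 ≤ mu) : soft mu x = max 0 (x - mu) - max 0 (-x - mu) := by
  unfold soft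
  rcases lt_trichotomy x 0 with h | h | h
  · rw [Real.sign_of_neg h, abs_of_neg h, max_eq_left (show x - mu ≤ 0 by linarith)]; ring
  · subst h; simp
  · rw [Real.sign_of_pos h, abs_of_pos h, max_eq_left (show -x - mu ≤ 0 by linarith)]; ring

theorem soft_lip (mu x y : ℝ) (hmu : 0 ≤ mu) : |soft mu x - soft mu y| ≤ |x - y| := by
  rw [soft_eq mu x hmu, soft_eq mu y hmu]
  rcases max_cases 0 (x - mu) with ⟨h1, h1'⟩ | ⟨h1, h1'⟩ <;>
  rcases max_cases 0 (-x - mu) with ⟨h2, h2'⟩ | ⟨h2, h2'⟩ <;>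
  rcases max_cases 0 (y - mu) with ⟨h3, h3'⟩ | ⟨h3, h3'⟩ <;>
  rcases max_cases 0 (-y - mu) with ⟨h4, h4'⟩ | ⟨h4, h4'⟩ <;>
  rw [h1, h2, h3, h4] <;>
  rcases abs_cases (x - y) with ⟨h5, h5'⟩ | ⟨h5, h5'⟩ <;> rw [h5, abs_le] <;>
  constructor <;> linarith

noncomputable def softE {N : ℕ} (mu : ℝ) (x : EuclideanSpace ℝ (Fin N)) :
    EuclideanSpace ℝ (Fin N) := WithLp.toLp 2 fun i => soft mu (x i)

theorem softE_lip {N : ℕ} (mu : ℝ) (hmu : 0 ≤ mu) (x y : EuclideanSpace ℝ (Fin N)) :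
    ‖softE mu x - softE mu y‖ ≤ ‖x - y‖ := by
  rw [EuclideanSpace.norm_eq, EuclideanSpace.norm_eq]
  refine Real.sqrt_le_sqrt (Finset.sum_le_sum fun i _ => ?_)
  exact pow_le_pow_left₀ (norm_nonneg _) (soft_lip mu (x i) (y i) hmu) 2

theorem softE_zero {N : ℕ} (mu : ℝ) : softE mu (0 : EuclideanSpace ℝ (Fin N)) = 0 := by
  ext i; simp [softE, soft_zero]

theorem softE_norm {N : ℕ} (mu : ℝ) (hmu : 0 ≤ mu) (x : EuclideanSpace ℝ (Fin N)) :
    ‖softE mu x‖ ≤ ‖x‖ := by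
  have := softE_lip mu hmu x 0
  simpa [softE_zero] using this

theorem softE_continuous {N : ℕ} (mu : ℝ) (hmu : 0 ≤ mu) :
    Continuous (softE mu : EuclideanSpace ℝ (Fin N) → EuclideanSpace ℝ (Fin N)) := by
  have : LipschitzWith 1 (softE mu : EuclideanSpace ℝ (Fin N) → EuclideanSpace ℝ (Fin N)) :=
    LipschitzWith.of_dist_le_mul fun x y => by
      rw [dist_eq_norm, dist_eq_norm]; simpa using softE_lip mu hmu x y
  exact this.continuous

section proj
variable {H : Type*} [NormedAddCommGroup H] [InnerProductSpace ℝ H]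

noncomputable def sigE (B : ℝ) (x : H) : H := if ‖x‖ ≤ B then x else (B / ‖x‖) • x

theorem sigE_norm (B : ℝ) (hB : 0 ≤ B) (x : H) : ‖sigE B x‖ ≤ B := by
  unfold sigE
  split_ifs with h
  · exact h
  · push Not at h
    have : 0 < ‖x‖ := lt_of_le_of_lt hB h
    rw [norm_smul, Real.norm_of_nonneg (by positivity)]
    field_simp; rfl

theorem sigE_var (B : ℝ) (hB : 0 ≤ B) (x z : H) (hz : ‖z‖ ≤ B) :
    inner ℝ (x - sigE B x) (z - sigE B x) ≤ 0 := by
  unfold sigE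
  split_ifs with h
  · simp
  · push Not at h
    have hx : 0 < ‖x‖ := lt_of_le_of_lt hB h
    have e : x - (B / ‖x‖) • x = (1 - B / ‖x‖) • x := by rw [sub_smul, one_smul]
    rw [e, real_inner_smul_left, inner_sub_right, real_inner_smul_right, real_inner_self_eq_norm_sq]
    have h1 : B / ‖x‖ ≤ 1 := by rw [div_le_one hx]; exact h.le
    refine mul_nonpos_of_nonneg_of_nonpos (by linarith) ?_
    have h2 : B / ‖x‖ * ‖x‖ ^ 2 = B * ‖x‖ := by field_simp
    have h3 := real_inner_le_norm x z
    have h4 := mul_le_mul_of_nonneg_left hz hx.le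
    rw [h2]; linarith

theorem sigE_lip (B : ℝ) (hB : 0 ≤ B) (x y : H) : ‖sigE B x - sigE B y‖ ≤ ‖x - y‖ := by
  have h1 := sigE_var B hB x (sigE B y) (sigE_norm B hB y)
  have h2 := sigE_var B hB y (sigE B x) (sigE_norm B hB x)
  set p := sigE B x
  set q := sigE B y
  have h3 : ‖p - q‖ ^ 2 ≤ inner ℝ (x - y) (p - q) := by
    rw [← real_inner_self_eq_norm_sq]
    have e1 : inner ℝ (x - p) (q - p) = - inner ℝ (x - p) (p - q) := by
      rw [← inner_neg_right, neg_sub]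
    have e2 : inner ℝ (x - y) (p - q) - inner ℝ (p - q) (p - q)
        = inner ℝ (x - p) (p - q) - inner ℝ (y - q) (p - q) := by
      rw [← inner_sub_left, ← inner_sub_left]; congr 1; abel
    linarith
  have h4 := h3.trans (real_inner_le_norm _ _)
  by_contra! hcon
  nlinarith [norm_nonneg (x - y), norm_nonneg (p - q)]

theorem sigE_continuous (B : ℝ) (hB : 0 ≤ B) : Continuous (sigE B : H → H) := by
  have : LipschitzWith 1 (sigE B : H → H) :=
    LipschitzWith.of_dist_le_mul fun x y => by
      rw [dist_eq_norm, dist_eq_norm]; simpa using sigE_lip B hB x y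
  exact this.continuous
end proj

section net
variable {n N : ℕ}

noncomputable def netE (τ lam : ℝ) (W : EuclideanSpace ℝ (Fin N) →L[ℝ] EuclideanSpace ℝ (Fin n)) (y : EuclideanSpace ℝ (Fin n)) :
    ℕ → EuclideanSpace ℝ (Fin N)
  | 0 => 0
  | l + 1 => softE (τ * lam) (netE τ lam W y l
      - τ • (ContinuousLinearMap.adjoint W (W (netE τ lam W y l)))
      + τ • (ContinuousLinearMap.adjoint W y))

theorem netE_continuous (τ lam : ℝ) (h : 0 ≤ τ * lam) (l : ℕ) :
    Continuous fun z : (EuclideanSpace ℝ (Fin N) →L[ℝ] EuclideanSpace ℝ (Fin n)) × EuclideanSpace ℝ (Fin n) => netE τ lam z.1 z.2 l := by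
  induction l with
  | zero => simp only [netE]; exact continuous_const
  | succ l ih =>
    simp only [netE]
    refine (softE_continuous _ h).comp ?_
    have hadj : Continuous fun z : (EuclideanSpace ℝ (Fin N) →L[ℝ] EuclideanSpace ℝ (Fin n)) × EuclideanSpace ℝ (Fin n) =>
        ContinuousLinearMap.adjoint z.1 :=
      (ContinuousLinearMap.adjoint (𝕜 := ℝ) (E := EuclideanSpace ℝ (Fin N)) (F := EuclideanSpace ℝ (Fin n))).continuous.comp
        continuous_fst
    exact (ih.sub ((hadj.clm_apply (continuous_fst.clm_apply ih)).const_smul τ)).add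
      ((hadj.clm_apply continuous_snd).const_smul τ)

theorem contraction (τ : ℝ) (hτ : 0 ≤ τ) (W : EuclideanSpace ℝ (Fin N) →L[ℝ] EuclideanSpace ℝ (Fin n)) (hW : τ * ‖W‖ ^ 2 ≤ 1)
    (x : EuclideanSpace ℝ (Fin N)) : ‖x - τ • (ContinuousLinearMap.adjoint W (W x))‖ ≤ ‖x‖ := by
  apply le_of_sq_le_sq _ (norm_nonneg _)
  rw [norm_sub_sq_real, real_inner_smul_right, ContinuousLinearMap.adjoint_inner_right,
    real_inner_self_eq_norm_sq, norm_smul, Real.norm_of_nonneg hτ, mul_pow]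
  have h1 : ‖ContinuousLinearMap.adjoint W (W x)‖ ≤ ‖W‖ * ‖W x‖ := by
    have := (ContinuousLinearMap.adjoint W).le_opNorm (W x)
    rwa [LinearIsometryEquiv.norm_map] at this
  have h2 := pow_le_pow_left₀ (norm_nonneg _) h1 2
  rw [mul_pow] at h2
  have h3 : τ ^ 2 * ‖ContinuousLinearMap.adjoint W (W x)‖ ^ 2 ≤ τ ^ 2 * (‖W‖ ^ 2 * ‖W x‖ ^ 2) :=
    mul_le_mul_of_nonneg_left h2 (sq_nonneg τ)
  have h4 : τ ^ 2 * (‖W‖ ^ 2 * ‖W x‖ ^ 2) = (τ * ‖W x‖ ^ 2) * (τ * ‖W‖ ^ 2) := by ring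
  have h5 : (τ * ‖W x‖ ^ 2) * (τ * ‖W‖ ^ 2) ≤ (τ * ‖W x‖ ^ 2) * 1 :=
    mul_le_mul_of_nonneg_left hW (by positivity)
  have h6 : 0 ≤ τ * ‖W x‖ ^ 2 := by positivity
  linarith

theorem adj_apply_le (W : EuclideanSpace ℝ (Fin N) →L[ℝ] EuclideanSpace ℝ (Fin n)) (y : EuclideanSpace ℝ (Fin n)) :
    ‖ContinuousLinearMap.adjoint W y‖ ≤ ‖W‖ * ‖y‖ := by
  have := (ContinuousLinearMap.adjoint W).le_opNorm y
  rwa [LinearIsometryEquiv.norm_map] at this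

theorem netE_norm (τ lam a : ℝ) (hτ : 0 ≤ τ) (hl : 0 ≤ lam)
    (ha1 : τ * a ^ 2 ≤ 1) (W : EuclideanSpace ℝ (Fin N) →L[ℝ] EuclideanSpace ℝ (Fin n)) (hW : ‖W‖ ≤ a)
    (y : EuclideanSpace ℝ (Fin n)) (l : ℕ) : ‖netE τ lam W y l‖ ≤ τ * l * a * ‖y‖ := by
  have hW2 : τ * ‖W‖ ^ 2 ≤ 1 :=
    (mul_le_mul_of_nonneg_left (pow_le_pow_left₀ (norm_nonneg _) hW 2) hτ).trans ha1
  induction l with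
  | zero => simp [netE]
  | succ l ih =>
    rw [netE]
    refine (softE_norm _ (mul_nonneg hτ hl) _).trans ((norm_add_le _ _).trans ?_)
    have h1 := contraction τ hτ W hW2 (netE τ lam W y l)
    have h2 : ‖τ • (ContinuousLinearMap.adjoint W y)‖ ≤ τ * (a * ‖y‖) := by
      rw [norm_smul, Real.norm_of_nonneg hτ]
      exact mul_le_mul_of_nonneg_left ((adj_apply_le W y).trans
        (mul_le_mul_of_nonneg_right hW (norm_nonneg _))) hτ
    push_cast
    linarith

theorem netE_lip (τ lam a : ℝ) (hτ : 0 ≤ τ) (hl : 0 ≤ lam) (ha : 0 ≤ a)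
    (ha1 : τ * a ^ 2 ≤ 1) (W W' : EuclideanSpace ℝ (Fin N) →L[ℝ] EuclideanSpace ℝ (Fin n)) (hW : ‖W‖ ≤ a) (hW' : ‖W'‖ ≤ a)
    (y : EuclideanSpace ℝ (Fin n)) (l : ℕ) :
    ‖netE τ lam W y l - netE τ lam W' y l‖ ≤ τ * l ^ 2 * ‖y‖ * ‖W - W'‖ := by
  have hW2 : τ * ‖W‖ ^ 2 ≤ 1 :=
    (mul_le_mul_of_nonneg_left (pow_le_pow_left₀ (norm_nonneg _) hW 2) hτ).trans ha1
  induction l with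
  | zero => simp [netE]
  | succ l ih =>
    rw [netE, netE]
    refine (softE_lip _ (mul_nonneg hτ hl) _ _).trans ?_
    have hf' := netE_norm τ lam a hτ hl ha1 W' hW' y l
    set f := netE τ lam W y l
    set f' := netE τ lam W' y l
    have e : f - τ • (ContinuousLinearMap.adjoint W (W f)) + τ • (ContinuousLinearMap.adjoint W y)
        - (f' - τ • (ContinuousLinearMap.adjoint W' (W' f'))
          + τ • (ContinuousLinearMap.adjoint W' y))
        = ((f - f') - τ • (ContinuousLinearMap.adjoint W (W (f - f'))))
          - τ • (ContinuousLinearMap.adjoint W ((W - W') f'))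
          - τ • (ContinuousLinearMap.adjoint (W - W') (W' f'))
          + τ • (ContinuousLinearMap.adjoint (W - W') y) := by
      simp only [map_sub, ContinuousLinearMap.sub_apply, smul_sub]
      abel
    rw [e]
    have h1 := contraction τ hτ W hW2 (f - f')
    have hd := norm_nonneg (W - W')
    have h2 : ‖τ • (ContinuousLinearMap.adjoint W ((W - W') f'))‖
        ≤ τ * (a * (‖W - W'‖ * ‖f'‖)) := by
      rw [norm_smul, Real.norm_of_nonneg hτ]
      refine mul_le_mul_of_nonneg_left ((adj_apply_le W _).trans ?_) hτ
      exact mul_le_mul hW ((W - W').le_opNorm f') (norm_nonneg _) ha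
    have h3 : ‖τ • (ContinuousLinearMap.adjoint (W - W') (W' f'))‖
        ≤ τ * (‖W - W'‖ * (a * ‖f'‖)) := by
      rw [norm_smul, Real.norm_of_nonneg hτ]
      refine mul_le_mul_of_nonneg_left ((adj_apply_le _ _).trans ?_) hτ
      exact mul_le_mul_of_nonneg_left ((W'.le_opNorm f').trans
        (mul_le_mul_of_nonneg_right hW' (norm_nonneg _))) hd
    have h4 : ‖τ • (ContinuousLinearMap.adjoint (W - W') y)‖ ≤ τ * (‖W - W'‖ * ‖y‖) := by
      rw [norm_smul, Real.norm_of_nonneg hτ]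
      exact mul_le_mul_of_nonneg_left (adj_apply_le _ _) hτ
    have h5 : τ * (a * (‖W - W'‖ * ‖f'‖)) ≤ τ * ‖W - W'‖ * l * ‖y‖ := by
      calc τ * (a * (‖W - W'‖ * ‖f'‖)) = (τ * a * ‖W - W'‖) * ‖f'‖ := by ring
        _ ≤ (τ * a * ‖W - W'‖) * (τ * l * a * ‖y‖) :=
            mul_le_mul_of_nonneg_left hf' (by positivity)
        _ = (τ * ‖W - W'‖ * l * ‖y‖) * (τ * a ^ 2) := by ring
        _ ≤ (τ * ‖W - W'‖ * l * ‖y‖) * 1 := mul_le_mul_of_nonneg_left ha1 (by positivity)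
        _ = _ := by ring
    have h6 : τ * (‖W - W'‖ * (a * ‖f'‖)) = τ * (a * (‖W - W'‖ * ‖f'‖)) := by ring
    have t1 := norm_add_le ((f - f') - τ • (ContinuousLinearMap.adjoint W (W (f - f')))
          - τ • (ContinuousLinearMap.adjoint W ((W - W') f'))
          - τ • (ContinuousLinearMap.adjoint (W - W') (W' f')))
          (τ • (ContinuousLinearMap.adjoint (W - W') y))
    have t2 := norm_sub_le ((f - f') - τ • (ContinuousLinearMap.adjoint W (W (f - f')))
          - τ • (ContinuousLinearMap.adjoint W ((W - W') f')))
          (τ • (ContinuousLinearMap.adjoint (W - W') (W' f')))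
    have t3 := norm_sub_le ((f - f') - τ • (ContinuousLinearMap.adjoint W (W (f - f'))))
          (τ • (ContinuousLinearMap.adjoint W ((W - W') f')))
    have ec : ((l + 1 : ℕ) : ℝ) = (l : ℝ) + 1 := Nat.cast_succ l
    rw [ec]
    have e7 : τ * ((l : ℝ) + 1) ^ 2 * ‖y‖ * ‖W - W'‖ = τ * (l : ℝ) ^ 2 * ‖y‖ * ‖W - W'‖
        + 2 * (τ * ‖W - W'‖ * l * ‖y‖) + τ * (‖W - W'‖ * ‖y‖) := by ring
    rw [e7]
    linarith

noncomputable def lossE (τ lam B a : ℝ) (L : ℕ) (A : EuclideanSpace ℝ (Fin N) →L[ℝ] EuclideanSpace ℝ (Fin n))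
    (p : (EuclideanSpace ℝ (Fin N) →L[ℝ] EuclideanSpace ℝ (Fin N)) × (EuclideanSpace ℝ (Fin N) →L[ℝ] EuclideanSpace ℝ (Fin n))) (x : EuclideanSpace ℝ (Fin N)) : ℝ :=
  ‖sigE B (p.1 (netE τ lam (a • p.2) (A x) L)) - x‖

theorem lossE_continuous (τ lam B a : ℝ) (h : 0 ≤ τ * lam) (hB : 0 ≤ B) (L : ℕ)
    (A : EuclideanSpace ℝ (Fin N) →L[ℝ] EuclideanSpace ℝ (Fin n)) :
    Continuous fun z : ((EuclideanSpace ℝ (Fin N) →L[ℝ] EuclideanSpace ℝ (Fin N)) × (EuclideanSpace ℝ (Fin N) →L[ℝ] EuclideanSpace ℝ (Fin n)))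
      × EuclideanSpace ℝ (Fin N) => lossE τ lam B a L A z.1 z.2 := by
  unfold lossE
  refine (((sigE_continuous B hB).comp ?_).sub continuous_snd).norm
  refine (continuous_fst.fst).clm_apply ?_
  exact (netE_continuous τ lam h L).comp
    ((continuous_fst.snd.const_smul a).prodMk (A.continuous.comp continuous_snd))

theorem lossE_base (τ lam B a : ℝ) (hB : 0 ≤ B) (L : ℕ) (A : EuclideanSpace ℝ (Fin N) →L[ℝ] EuclideanSpace ℝ (Fin n))
    (p : (EuclideanSpace ℝ (Fin N) →L[ℝ] EuclideanSpace ℝ (Fin N)) × (EuclideanSpace ℝ (Fin N) →L[ℝ] EuclideanSpace ℝ (Fin n))) (x : EuclideanSpace ℝ (Fin N)) :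
    |lossE τ lam B a L A p x - ‖x‖| ≤ B := by
  have h1 := abs_norm_sub_norm_le (sigE B (p.1 (netE τ lam (a • p.2) (A x) L)) - x) (-x)
  rw [norm_neg, sub_neg_eq_add, sub_add_cancel] at h1
  exact h1.trans (sigE_norm B hB _)

theorem lossE_lip (τ lam B a : ℝ) (hτ : 0 ≤ τ) (hl : 0 ≤ lam) (hB : 0 ≤ B) (ha : 0 ≤ a)
    (ha1 : τ * a ^ 2 ≤ 1) (L : ℕ) (A : EuclideanSpace ℝ (Fin N) →L[ℝ] EuclideanSpace ℝ (Fin n))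
    (p q : (EuclideanSpace ℝ (Fin N) →L[ℝ] EuclideanSpace ℝ (Fin N)) × (EuclideanSpace ℝ (Fin N) →L[ℝ] EuclideanSpace ℝ (Fin n))) (x : EuclideanSpace ℝ (Fin N))
    (hp2 : ‖p.2‖ ≤ 1) (hq1 : ‖q.1‖ ≤ 1) (hq2 : ‖q.2‖ ≤ 1) :
    |lossE τ lam B a L A p x - lossE τ lam B a L A q x|
      ≤ (τ * L * a * ‖p.1 - q.1‖ + τ * L ^ 2 * a * ‖p.2 - q.2‖) * ‖A x‖ := by
  have hpW : ‖a • p.2‖ ≤ a := by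
    rw [norm_smul, Real.norm_of_nonneg ha]; nlinarith
  have hqW : ‖a • q.2‖ ≤ a := by
    rw [norm_smul, Real.norm_of_nonneg ha]; nlinarith
  unfold lossE
  refine (abs_norm_sub_norm_le _ _).trans ?_
  rw [sub_sub_sub_cancel_right]
  refine (sigE_lip B hB _ _).trans ?_
  have h1 := netE_norm τ lam a hτ hl ha1 _ hpW (A x) L
  have h2 := netE_lip τ lam a hτ hl ha ha1 _ _ hpW hqW (A x) L
  have e3 : a • p.2 - a • q.2 = a • (p.2 - q.2) := (smul_sub a p.2 q.2).symm
  rw [e3, norm_smul, Real.norm_of_nonneg ha] at h2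
  set f := netE τ lam (a • p.2) (A x) L
  set f' := netE τ lam (a • q.2) (A x) L
  have e : p.1 f - q.1 f' = (p.1 - q.1) f + q.1 (f - f') := by
    simp only [map_sub, ContinuousLinearMap.sub_apply]; abel
  rw [e]
  have h3 := (p.1 - q.1).le_opNorm f
  have h4 : ‖q.1 (f - f')‖ ≤ ‖f - f'‖ := by
    have := q.1.le_opNorm (f - f')
    nlinarith [norm_nonneg (f - f')]
  have h5 := mul_le_mul_of_nonneg_left h1 (norm_nonneg (p.1 - q.1))
  refine (norm_add_le _ _).trans ?_
  nlinarith

end net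

section trans

noncomputable def clm {a b : ℕ} (A : Matrix (Fin a) (Fin b) ℝ) :
    EuclideanSpace ℝ (Fin b) →L[ℝ] EuclideanSpace ℝ (Fin a) :=
  LinearMap.toContinuousLinearMap (Matrix.toEuclideanLin A)

theorem clm_apply' {a b : ℕ} (A : Matrix (Fin a) (Fin b) ℝ) (x : Fin b → ℝ) :
    clm A (WithLp.toLp 2 x) = WithLp.toLp 2 (A *ᵥ x) := by
  simp [clm]

theorem clm_norm {a b : ℕ} (A : Matrix (Fin a) (Fin b) ℝ) : ‖clm A‖ = specNorm A := rfl

theorem clm_adjoint {a b : ℕ} (A : Matrix (Fin a) (Fin b) ℝ) :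
    ContinuousLinearMap.adjoint (clm A) = clm Aᵀ := by
  have h := Matrix.toEuclideanLin_conjTranspose_eq_adjoint A
  rw [Matrix.conjTranspose_eq_transpose_of_trivial] at h
  unfold clm
  rw [h]
  rfl

theorem clm_adj_apply {a b : ℕ} (A : Matrix (Fin a) (Fin b) ℝ) (y : Fin a → ℝ) :
    ContinuousLinearMap.adjoint (clm A) (WithLp.toLp 2 y) = WithLp.toLp 2 (Aᵀ *ᵥ y) := by
  rw [clm_adjoint, clm_apply']

theorem l2_eq {N : ℕ} (x : Fin N → ℝ) : l2 x = ‖(WithLp.toLp 2 x : EuclideanSpace ℝ (Fin N))‖ := by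
  rw [EuclideanSpace.norm_eq]; simp [l2]

theorem sigma_eq {N : ℕ} (B : ℝ) (x : Fin N → ℝ) :
    (WithLp.toLp 2 (sigma B x) : EuclideanSpace ℝ (Fin N)) = sigE B (WithLp.toLp 2 x) := by
  unfold sigma sigE
  rw [← l2_eq]
  split_ifs <;> rfl

theorem istaVec_eq {n N : ℕ} (A : Matrix (Fin n) (Fin N) ℝ) (τ lam : ℝ)
    (Φ : Matrix (Fin N) (Fin N) ℝ) (y : Fin n → ℝ) (l : ℕ) :
    (WithLp.toLp 2 (istaVec A τ lam Φ y l) : EuclideanSpace ℝ (Fin N))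
      = netE τ lam (clm (A * Φ)) (WithLp.toLp 2 y) l := by
  induction l with
  | zero => simp [istaVec, netE]
  | succ l ih =>
    rw [netE, ← ih, clm_apply', clm_adj_apply, clm_adj_apply, istaVec]
    have e : Φᵀ * Aᵀ * A * Φ = (A * Φ)ᵀ * (A * Φ) := by
      rw [Matrix.transpose_mul]; simp only [Matrix.mul_assoc]
    rw [e, Matrix.sub_mulVec, Matrix.one_mulVec, Matrix.smul_mulVec, ← Matrix.mulVec_mulVec]
    rfl

theorem frob_eq {n N m : ℕ} (A : Matrix (Fin n) (Fin N) ℝ) (X : Fin m → Fin N → ℝ) :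
    frobNorm (A * Matrix.of fun k i => X i k)
      = Real.sqrt (∑ i, ‖clm A (WithLp.toLp 2 (X i))‖ ^ 2) := by
  unfold frobNorm
  rw [Finset.sum_comm]
  congr 1
  refine Finset.sum_congr rfl fun i _ => ?_
  rw [clm_apply', EuclideanSpace.norm_sq_eq]
  refine Finset.sum_congr rfl fun j _ => ?_
  rw [Real.norm_eq_abs, sq_abs]
  rfl

theorem clm_orth {N : ℕ} (Ψ : Matrix (Fin N) (Fin N) ℝ) (h : IsOrthogonal Ψ) : ‖clm Ψ‖ ≤ 1 := by
  refine ContinuousLinearMap.opNorm_le_bound _ zero_le_one fun x => ?_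
  rw [one_mul]
  apply le_of_sq_le_sq _ (norm_nonneg _)
  rw [← real_inner_self_eq_norm_sq, ← ContinuousLinearMap.adjoint_inner_right]
  have e : ContinuousLinearMap.adjoint (clm Ψ) (clm Ψ x) = x := by
    have hx : x = WithLp.toLp 2 x.ofLp := rfl
    rw [hx, clm_apply', clm_adj_apply, Matrix.mulVec_mulVec, h, Matrix.one_mulVec]
  rw [e, real_inner_self_eq_norm_sq]

theorem clm_mul {a b c : ℕ} (A : Matrix (Fin a) (Fin b) ℝ) (B : Matrix (Fin b) (Fin c) ℝ) :
    clm (A * B) = (clm A).comp (clm B) := by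
  ext1 x
  have hx : x = WithLp.toLp 2 x.ofLp := rfl
  rw [ContinuousLinearMap.comp_apply, hx, clm_apply', clm_apply', clm_apply', Matrix.mulVec_mulVec]

theorem clm_par {n N : ℕ} (A : Matrix (Fin n) (Fin N) ℝ) (Φ : Matrix (Fin N) (Fin N) ℝ)
    (h : IsOrthogonal Φ) : ∃ V : EuclideanSpace ℝ (Fin N) →L[ℝ] EuclideanSpace ℝ (Fin n),
      ‖V‖ ≤ 1 ∧ specNorm A • V = clm (A * Φ) := by
  have h1 : ‖clm (A * Φ)‖ ≤ specNorm A := by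
    rw [clm_mul, ← clm_norm]
    refine (ContinuousLinearMap.opNorm_comp_le _ _).trans ?_
    have := clm_orth Φ h
    nlinarith [norm_nonneg (clm A)]
  have h0 : 0 ≤ specNorm A := norm_nonneg _
  rcases h0.eq_or_lt with ha | ha
  · refine ⟨0, by simp, ?_⟩
    rw [← ha] at h1
    have : clm (A * Φ) = 0 := norm_le_zero_iff.mp h1
    rw [this]
    ext1 x
    simp
  · refine ⟨(specNorm A)⁻¹ • clm (A * Φ), ?_, ?_⟩
    · rw [norm_smul, norm_inv, Real.norm_of_nonneg h0, inv_mul_le_iff₀ ha]; linarith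
    · rw [smul_smul, mul_inv_cancel₀ ha.ne', one_smul]

theorem finrank_clm (a b : ℕ) :
    Module.finrank ℝ (EuclideanSpace ℝ (Fin b) →L[ℝ] EuclideanSpace ℝ (Fin a)) = b * a := by
  rw [← (LinearMap.toContinuousLinearMap (𝕜 := ℝ) (E := EuclideanSpace ℝ (Fin b))
    (F' := EuclideanSpace ℝ (Fin a))).finrank_eq, Module.finrank_linearMap]
  simp

theorem loss_eq {n N : ℕ} (A : Matrix (Fin n) (Fin N) ℝ) (τ lam B : ℝ) (L : ℕ)
    (Ψ Φ : Matrix (Fin N) (Fin N) ℝ) (V : EuclideanSpace ℝ (Fin N) →L[ℝ] EuclideanSpace ℝ (Fin n))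
    (hV : specNorm A • V = clm (A * Φ)) (x : Fin N → ℝ) :
    l2 (sigma B (Ψ *ᵥ istaVec A τ lam Φ (A *ᵥ x) L) - x)
      = lossE τ lam B (specNorm A) L (clm A) (clm Ψ, V) (WithLp.toLp 2 x) := by
  unfold lossE
  simp only
  rw [hV, clm_apply', ← istaVec_eq, clm_apply', ← sigma_eq, l2_eq]
  rfl

end trans

theorem final_arith (n N m L : ℕ) (hm : 0 < m) (hL : 2 ≤ L) (B s : ℝ) (hB : 0 < B) (hs : 0 ≤ s) :
    (2 / (m : ℝ)) * (2 * √2 * (√m * B) * (√((N * N : ℕ) : ℝ) * √(2 + Real.log (1 + 4 * (L * s)))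
      + √((N * n : ℕ) : ℝ) * √(2 + Real.log (1 + 4 * (L ^ 2 * s)))))
    ≤ 8 * B * √((N : ℝ) * n / m) * √(1 + Real.log (2 + 8 * L * (L + 3) * s))
      + 8 * B * (N / √m) * √(Real.log (Real.exp 1 * (1 + 8 * L * s))) := by
  have hm' : (0 : ℝ) < m := by exact_mod_cast hm
  have hL' : (2 : ℝ) ≤ L := by exact_mod_cast hL
  have h1 : √2 * √(2 + Real.log (1 + 4 * (L * s))) ≤
      2 * √(Real.log (Real.exp 1 * (1 + 8 * L * s))) := by
    have e : (2 : ℝ) * √(Real.log (Real.exp 1 * (1 + 8 * L * s)))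
        = √(4 * Real.log (Real.exp 1 * (1 + 8 * L * s))) := by
      rw [Real.sqrt_mul (by norm_num), show (4 : ℝ) = 2 ^ 2 by norm_num,
        Real.sqrt_sq (by norm_num)]
    rw [e, ← Real.sqrt_mul (by norm_num)]
    apply Real.sqrt_le_sqrt
    have hp : 0 ≤ L * s := by positivity
    rw [Real.log_mul (Real.exp_pos 1).ne' (by nlinarith), Real.log_exp]
    have hl : Real.log (1 + 4 * (L * s)) ≤ Real.log (1 + 8 * L * s) :=
      Real.log_le_log (by nlinarith) (by nlinarith)
    have h0 : 0 ≤ Real.log (1 + 4 * (L * s)) := Real.log_nonneg (by nlinarith)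
    linarith
  have h2 : √2 * √(2 + Real.log (1 + 4 * (L ^ 2 * s))) ≤
      2 * √(1 + Real.log (2 + 8 * L * (L + 3) * s)) := by
    have e : (2 : ℝ) * √(1 + Real.log (2 + 8 * L * (L + 3) * s))
        = √(4 * (1 + Real.log (2 + 8 * L * (L + 3) * s))) := by
      rw [Real.sqrt_mul (by norm_num), show (4 : ℝ) = 2 ^ 2 by norm_num,
        Real.sqrt_sq (by norm_num)]
    rw [e, ← Real.sqrt_mul (by norm_num)]
    apply Real.sqrt_le_sqrt
    have hp : 0 ≤ L * s := by positivity
    have hp2 : 0 ≤ L ^ 2 * s := by positivity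
    have hl : Real.log (1 + 4 * (L ^ 2 * s)) ≤ Real.log (2 + 8 * L * (L + 3) * s) :=
      Real.log_le_log (by nlinarith) (by nlinarith)
    have h0 : 0 ≤ Real.log (1 + 4 * (L ^ 2 * s)) := Real.log_nonneg (by nlinarith)
    linarith
  have e1 : √((N * N : ℕ) : ℝ) = N := by
    push_cast; exact Real.sqrt_mul_self (Nat.cast_nonneg N)
  have e2 : √((N : ℝ) * n / m) = √((N * n : ℕ) : ℝ) / √m := by
    push_cast; exact Real.sqrt_div (by positivity) _
  have hsm : √(m : ℝ) * √m = m := Real.mul_self_sqrt hm'.le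
  have hsm0 : 0 < √(m : ℝ) := Real.sqrt_pos.mpr hm'
  rw [e1, e2]
  set S1 := √(2 + Real.log (1 + 4 * (L * s)))
  set S2 := √(2 + Real.log (1 + 4 * (L ^ 2 * s)))
  set Q := √((N * n : ℕ) : ℝ)
  have hQ : 0 ≤ Q := Real.sqrt_nonneg _
  set r := √(m : ℝ)
  rw [← hsm]
  have e3 : 2 / (r * r) * (2 * √2 * (r * B) * (N * S1 + Q * S2))
      = (4 * B * (Q / r)) * (√2 * S2) + (4 * B * (N / r)) * (√2 * S1) := by
    field_simp
    ring
  rw [e3]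
  have i1 := mul_le_mul_of_nonneg_left h2 (show 0 ≤ 4 * B * (Q / r) by positivity)
  have i2 := mul_le_mul_of_nonneg_left h1 (show 0 ≤ 4 * B * (N / r) by positivity)
  linarith

theorem abs_min_sub (a b c : ℝ) : |min a c - min b c| ≤ |a - b| := by
  have := abs_min_sub_min_le_max a c b c
  simpa using this

theorem rad_bound {n N m : ℕ} (hm : 0 < m) (A : Matrix (Fin n) (Fin N) ℝ)
    (τ lam : ℝ) (hτ : 0 < τ) (hlam : 0 < lam) (hA : τ * specNorm A ^ 2 ≤ 1)
    (L : ℕ) (B c : ℝ) (hB : 0 < B) (X : Fin m → Fin N → ℝ)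
    (T : Finset ((EuclideanSpace ℝ (Fin N) →L[ℝ] EuclideanSpace ℝ (Fin N))
      × (EuclideanSpace ℝ (Fin N) →L[ℝ] EuclideanSpace ℝ (Fin n)))) (hT : T.Nonempty)
    (hTb : ∀ p ∈ T, ‖p.1‖ ≤ 1 ∧ ‖p.2‖ ≤ 1) (s : ℝ)
    (hs : s = τ * specNorm A * frobNorm (A * Matrix.of fun k i => X i k) / (√m * B)) :
    radW T hT (fun p i => min (lossE τ lam B (specNorm A) L (clm A) p (WithLp.toLp 2 (X i))) c)
      ≤ 2 * √2 * (√m * B) * (√((N * N : ℕ) : ℝ) * √(2 + Real.log (1 + 4 * (L * s)))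
      + √((N * n : ℕ) : ℝ) * √(2 + Real.log (1 + 4 * (L ^ 2 * s)))) := by
  have hm' : (0 : ℝ) < m := by exact_mod_cast hm
  have hsm0 : 0 < √(m : ℝ) := Real.sqrt_pos.mpr hm'
  have ha : 0 ≤ specNorm A := norm_nonneg _
  set a := specNorm A with hadef
  set F := frobNorm (A * Matrix.of fun k i => X i k) with hF
  have hF0 : 0 ≤ F := Real.sqrt_nonneg _
  have hF2 : F ^ 2 = ∑ i, ‖clm A (WithLp.toLp 2 (X i))‖ ^ 2 := by
    rw [hF, frob_eq, Real.sq_sqrt (Finset.sum_nonneg fun i _ => sq_nonneg _)]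
  have hs0 : 0 ≤ s := by rw [hs]; positivity
  refine (radW_shift T hT _ (fun i =>
    min ‖(WithLp.toLp 2 (X i) : EuclideanSpace ℝ (Fin N))‖ c)).trans ?_
  have key := chaining (fun (p : (EuclideanSpace ℝ (Fin N) →L[ℝ] EuclideanSpace ℝ (Fin N))
      × (EuclideanSpace ℝ (Fin N) →L[ℝ] EuclideanSpace ℝ (Fin n))) (i : Fin m) =>
      min (lossE τ lam B a L (clm A) p (WithLp.toLp 2 (X i))) c
        - min ‖(WithLp.toLp 2 (X i) : EuclideanSpace ℝ (Fin N))‖ c)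
      (√m * B) (L * s) (L ^ 2 * s) (by positivity) (by positivity) (by positivity) ?_ ?_ T hT hTb
  · rw [finrank_clm, finrank_clm] at key
    exact key
  · intro p q _ hp2 hq1 hq2
    have e : (√m * B * (L * s * ‖p.1 - q.1‖ + L ^ 2 * s * ‖p.2 - q.2‖)) ^ 2
        = ∑ i, ((τ * L * a * ‖p.1 - q.1‖ + τ * L ^ 2 * a * ‖p.2 - q.2‖)
          * ‖clm A (WithLp.toLp 2 (X i))‖) ^ 2 := by
      simp only [mul_pow _ ‖clm A _‖]
      rw [← Finset.mul_sum, ← hF2, ← mul_pow, hs]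
      congr 1
      field_simp
    rw [e]
    refine Finset.sum_le_sum fun i _ => ?_
    rw [sub_sub_sub_cancel_right, ← sq_abs]
    refine pow_le_pow_left₀ (abs_nonneg _) ((abs_min_sub _ _ _).trans ?_) 2
    exact lossE_lip τ lam B a hτ.le hlam.le hB.le ha hA L (clm A) p q _ hp2 hq1 hq2
  · intro p _ _
    have e : (√m * B) ^ 2 = ∑ i : Fin m, B ^ 2 := by
      rw [mul_pow, Real.sq_sqrt hm'.le]; simp
    rw [e]
    refine Finset.sum_le_sum fun i _ => ?_
    rw [← sq_abs]
    refine pow_le_pow_left₀ (abs_nonneg _) ((abs_min_sub _ _ _).trans ?_) 2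
    exact lossE_base τ lam B a hB.le L (clm A) p _

theorem radW_map {m : ℕ} {ι ι' : Type*} (T : Finset ι) (hT : T.Nonempty) (f : ι ↪ ι')
    (w : ι' → Fin m → ℝ) :
    radW T hT (fun p i => w (f p) i) = radW (T.map f) (hT.map (f := f)) w := by
  unfold radW
  congr 1
  refine Finset.sum_congr rfl fun e _ => ?_
  rw [Finset.sup'_map]
  rfl

theorem cont_right {n N : ℕ} (τ lam B a c : ℝ) (h : 0 ≤ τ * lam) (hB : 0 ≤ B) (L : ℕ)
    (A : EuclideanSpace ℝ (Fin N) →L[ℝ] EuclideanSpace ℝ (Fin n))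
    (p : (EuclideanSpace ℝ (Fin N) →L[ℝ] EuclideanSpace ℝ (Fin N))
      × (EuclideanSpace ℝ (Fin N) →L[ℝ] EuclideanSpace ℝ (Fin n))) :
    Continuous fun x : Fin N → ℝ => min (lossE τ lam B a L A p (WithLp.toLp 2 x)) c := by
  have h0 := lossE_continuous τ lam B a h hB L A
  have h1 : Continuous fun x : Fin N → ℝ =>
      (p, (WithLp.toLp 2 x : EuclideanSpace ℝ (Fin N))) :=
    continuous_const.prodMk (PiLp.continuous_toLp 2 _)
  have h2 := h0.comp h1
  simp only [Function.comp_def] at h2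
  exact h2.min continuous_const

theorem cont_left {n N : ℕ} (τ lam B a c : ℝ) (h : 0 ≤ τ * lam) (hB : 0 ≤ B) (L : ℕ)
    (A : EuclideanSpace ℝ (Fin N) →L[ℝ] EuclideanSpace ℝ (Fin n)) (x : Fin N → ℝ) :
    Continuous fun p : (EuclideanSpace ℝ (Fin N) →L[ℝ] EuclideanSpace ℝ (Fin N))
      × (EuclideanSpace ℝ (Fin N) →L[ℝ] EuclideanSpace ℝ (Fin n)) =>
      min (lossE τ lam B a L A p (WithLp.toLp 2 x)) c := by
  have h0 := lossE_continuous τ lam B a h hB L A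
  have h1 : Continuous fun p : (EuclideanSpace ℝ (Fin N) →L[ℝ] EuclideanSpace ℝ (Fin N))
      × (EuclideanSpace ℝ (Fin N) →L[ℝ] EuclideanSpace ℝ (Fin n)) =>
      (p, (WithLp.toLp 2 x : EuclideanSpace ℝ (Fin N))) :=
    continuous_id.prodMk continuous_const
  have h2 := h0.comp h1
  simp only [Function.comp_def] at h2
  exact h2.min continuous_const


theorem statement17 {n N m : ℕ} (hm : 0 < m) (A : Matrix (Fin n) (Fin N) ℝ)
    (τ lam : ℝ) (hτ : 0 < τ) (hlam : 0 < lam) (hA : τ * specNorm A ^ 2 ≤ 1)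
    (L : ℕ) (hL : 2 ≤ L)
    (Bin Bout : ℝ) (hBin : 0 < Bin) (hBout : 0 < Bout)
    (D : Measure (Fin N → ℝ)) [IsProbabilityMeasure D]
    (hbdd : ∀ᵐ x ∂D, l2 x ≤ Bin)
    (δ : ℝ) (hδ : 0 < δ) (hδ1 : δ < 1) :
    ENNReal.ofReal (1 - δ) ≤
      (Measure.pi fun _ : Fin m => D)
        {X : Fin m → Fin N → ℝ |
          ∀ Ψ Φ : Matrix (Fin N) (Fin N) ℝ, IsOrthogonal Ψ → IsOrthogonal Φ →
            (∫ x, l2 (sigma Bout (Ψ *ᵥ istaVec A τ lam Φ (A *ᵥ x) L) - x) ∂D) ≤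
              (1 / (m : ℝ)) * ∑ i, l2 (sigma Bout (Ψ *ᵥ istaVec A τ lam Φ (A *ᵥ X i) L) - X i)
              + 8 * Bout * Real.sqrt ((N : ℝ) * (n : ℝ) / (m : ℝ)) *
                  Real.sqrt (1 + Real.log (2 +
                    8 * (L : ℝ) * ((L : ℝ) + 3) * τ *
                      frobNorm (A * Matrix.of fun k i => X i k) * specNorm A /
                        (Real.sqrt (m : ℝ) * Bout)))
              + 8 * Bout * ((N : ℝ) / Real.sqrt (m : ℝ)) *
                  Real.sqrt (Real.log (Real.exp 1 * (1 +
                    8 * τ * (L : ℝ) * specNorm A *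
                      frobNorm (A * Matrix.of fun k i => X i k) /
                        (Real.sqrt (m : ℝ) * Bout))))
              + 4 * (Bin + Bout) * Real.sqrt (2 * Real.log (4 / δ) / (m : ℝ))} := by
  classical
  have hspec : 0 ≤ specNorm A := norm_nonneg _
  have hm' : (0 : ℝ) < m := by exact_mod_cast hm
  have hsm0 : 0 < √(m : ℝ) := Real.sqrt_pos.mpr hm'
  let PP := {p : (EuclideanSpace ℝ (Fin N) →L[ℝ] EuclideanSpace ℝ (Fin N))
      × (EuclideanSpace ℝ (Fin N) →L[ℝ] EuclideanSpace ℝ (Fin n)) // ‖p.1‖ ≤ 1 ∧ ‖p.2‖ ≤ 1}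
  have : Nonempty PP := ⟨⟨0, by simp⟩⟩
  let lo : PP → (Fin N → ℝ) → ℝ := fun p x =>
    min (lossE τ lam Bout (specNorm A) L (clm A) p.1 (WithLp.toLp 2 x)) (Bin + Bout)
  let s : (Fin m → Fin N → ℝ) → ℝ := fun X =>
    τ * specNorm A * frobNorm (A * Matrix.of fun k i => X i k) / (√m * Bout)
  let g : (Fin m → Fin N → ℝ) → ℝ := fun X =>
    8 * Bout * √((N : ℝ) * n / m) * √(1 + Real.log (2 + 8 * L * (L + 3) * s X))
      + 8 * Bout * (N / √m) * √(Real.log (Real.exp 1 * (1 + 8 * L * s X)))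
  have hmeas : ∀ p : PP, Measurable (lo p) := fun p =>
    (cont_right τ lam Bout (specNorm A) (Bin + Bout) (mul_pos hτ hlam).le hBout.le L (clm A)
      p.1).measurable
  have hlc : ∀ x, Continuous fun p : PP => lo p x := fun x =>
    (cont_left τ lam Bout (specNorm A) (Bin + Bout) (mul_pos hτ hlam).le hBout.le L (clm A)
      x).comp continuous_subtype_val
  have main := full_class hm D lo hmeas hlc (Bin + Bout) (by positivity)
    (fun p x => le_min (norm_nonneg _) (by positivity)) (fun p x => min_le_right _ _)
    δ hδ hδ1 g (by
      intro T hT X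
      have hF0 : 0 ≤ frobNorm (A * Matrix.of fun k i => X i k) := Real.sqrt_nonneg _
      have hs0 : 0 ≤ s X := by simp only [s]; positivity
      refine le_trans ?_ (final_arith n N m L hm hL Bout (s X) hBout hs0)
      refine mul_le_mul_of_nonneg_left ?_ (by positivity)
      have h1 := radW_map T hT (Function.Embedding.subtype _) (fun p i =>
        min (lossE τ lam Bout (specNorm A) L (clm A) p (WithLp.toLp 2 (X i))) (Bin + Bout))
      refine (le_of_eq h1).trans ?_
      refine rad_bound hm A τ lam hτ hlam hA L Bout (Bin + Bout) hBout X _ _ ?_ (s X) rfl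
      intro p hp
      obtain ⟨q, _, rfl⟩ := Finset.mem_map.mp hp
      exact q.2)
  refine main.trans (measure_mono_ae ?_)
  have hae : ∀ᵐ X ∂(Measure.pi fun _ : Fin m => D), ∀ i, l2 (X i) ≤ Bin := by
    rw [ae_all_iff]
    intro i
    exact (Measure.tendsto_eval_ae_ae (μ := fun _ : Fin m => D) (i := i)).eventually hbdd
  filter_upwards [hae] with X hX hmem
  intro Ψ Φ hΨ hΦ
  obtain ⟨V, hV1, hV⟩ := clm_par A Φ hΦ
  have heq : ∀ x : Fin N → ℝ, l2 x ≤ Bin →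
      lo ⟨(clm Ψ, V), clm_orth Ψ hΨ, hV1⟩ x
        = l2 (sigma Bout (Ψ *ᵥ istaVec A τ lam Φ (A *ᵥ x) L) - x) := by
    intro x hx
    rw [loss_eq A τ lam Bout L Ψ Φ V hV x]
    refine min_eq_left ?_
    have h1 := (abs_le.mp (lossE_base τ lam Bout (specNorm A) hBout.le L (clm A)
      (clm Ψ, V) (WithLp.toLp 2 x))).2
    rw [← l2_eq] at h1
    linarith
  have h2 := hmem ⟨(clm Ψ, V), clm_orth Ψ hΨ, hV1⟩
  have e1 : ∫ x, lo ⟨(clm Ψ, V), clm_orth Ψ hΨ, hV1⟩ x ∂D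
      = ∫ x, l2 (sigma Bout (Ψ *ᵥ istaVec A τ lam Φ (A *ᵥ x) L) - x) ∂D :=
    integral_congr_ae (hbdd.mono fun x hx => heq x hx)
  have e2 : ∑ i, lo ⟨(clm Ψ, V), clm_orth Ψ hΨ, hV1⟩ (X i)
      = ∑ i, l2 (sigma Bout (Ψ *ᵥ istaVec A τ lam Φ (A *ᵥ X i) L) - X i) :=
    Finset.sum_congr rfl fun i _ => heq (X i) (hX i)
  rw [e1, e2] at h2
  have e3 : 8 * (L : ℝ) * ((L : ℝ) + 3) * τ * frobNorm (A * Matrix.of fun k i => X i k)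
      * specNorm A / (√m * Bout) = 8 * L * (L + 3) * s X := by
    simp only [s]; ring
  have e4 : 8 * τ * (L : ℝ) * specNorm A * frobNorm (A * Matrix.of fun k i => X i k)
      / (√m * Bout) = 8 * L * s X := by
    simp only [s]; ring
  rw [e3, e4]
  simp only [g] at h2
  linarith
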